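/- arXiv:math/0306130 — 3 statements merged into one kernel-verified Lean document; each statement's English description precedes it below -/
import Mathlib

section
/- Let μ be a probability measure on ℝ with support contained in [-2,2] and moments a_n = ∫ x^n dμ. If the reciprocal Cauchy transform F of μ is univalent on the upper half-plane, then |1 + a₁² - a₂| ≤ 1. -/
open MeasureTheory Complex Set

section
open Real
noncomputable def cG (μ : Measure ℝ) (z : ℂ) : ℂ := ∫ x : ℝ, (z - (x : ℂ))⁻¹ ∂μ

def cU : Set ℂ := {z | ∀ x : ℝ, x ∈ Icc (-2:ℝ) 2 → z ≠ (x:ℂ)}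

lemma cU_dist {z : ℂ} (hz : z ∈ cU) : ∃ δ > 0, ∀ x : ℝ, x ∈ Icc (-2:ℝ) 2 → δ ≤ ‖z - x‖ := by
  have hc : IsCompact (Icc (-2:ℝ) 2) := isCompact_Icc
  obtain ⟨x0, hx0, h⟩ := hc.exists_isMinOn ⟨0, by norm_num, by norm_num⟩
    (f := fun x : ℝ => ‖z - x‖) (by fun_prop)
  refine ⟨‖z - x0‖, norm_pos_iff.2 (sub_ne_zero.2 (hz x0 hx0)), fun x hx => h hx⟩

lemma supp_ae {μ : Measure ℝ} (hsupp : μ (Set.Icc (-2 : ℝ) 2)ᶜ = 0) :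
    ∀ᵐ x ∂μ, x ∈ Icc (-2:ℝ) 2 := by
  rw [ae_iff]; exact hsupp

lemma int_pos {μ : Measure ℝ} [IsProbabilityMeasure μ] (hsupp : μ (Set.Icc (-2 : ℝ) 2)ᶜ = 0)
    {f : ℝ → ℝ} (hf : Integrable f μ) (h : ∀ x ∈ Icc (-2:ℝ) 2, 0 < f x) : 0 < ∫ x, f x ∂μ := by
  have h0 : 0 ≤ᵐ[μ] f := by
    filter_upwards [supp_ae hsupp] with x hx using (h x hx).le
  refine lt_of_le_of_ne (integral_nonneg_of_ae h0) fun h1 => ?_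
  have h2 := (integral_eq_zero_iff_of_nonneg_ae h0 hf).1 h1.symm
  have h3 : ∀ᵐ x ∂μ, False := by
    filter_upwards [supp_ae hsupp, h2] with x hx hx2
    exact (h x hx).ne' hx2
  obtain ⟨x, hx⟩ := h3.exists
  exact hx

lemma cG_int {μ : Measure ℝ} [IsProbabilityMeasure μ] (hsupp : μ (Set.Icc (-2 : ℝ) 2)ᶜ = 0)
   {z : ℂ} (hz : z ∈ cU) : Integrable (fun x : ℝ => (z - (x : ℂ))⁻¹) μ := by
  obtain ⟨δ, hδ, h⟩ := cU_dist hz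
  refine Integrable.of_bound (by fun_prop) (δ⁻¹) ?_
  filter_upwards [supp_ae hsupp] with x hx
  rw [norm_inv]
  exact inv_anti₀ hδ (h x hx)

lemma cG_diff {μ : Measure ℝ} [IsProbabilityMeasure μ] (hsupp : μ (Set.Icc (-2 : ℝ) 2)ᶜ = 0)
   {z : ℂ} (hz : z ∈ cU) : DifferentiableAt ℂ (cG μ) z := by
  obtain ⟨δ, hδ, h⟩ := cU_dist hz
  have := hasDerivAt_integral_of_dominated_loc_of_deriv_le (μ := μ)
    (F := fun (z:ℂ) (x : ℝ) => (z - (x : ℂ))⁻¹) (F' := fun (z:ℂ) (x:ℝ) => -1 / (z - (x : ℂ))^2)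
    (x₀ := z) (s := Metric.ball z (δ/2)) (bound := fun _ => ((δ/2)^2)⁻¹)
    (Metric.ball_mem_nhds z (by positivity)) (Filter.Eventually.of_forall fun w => by fun_prop)
    (cG_int hsupp hz) (Measurable.aestronglyMeasurable (by fun_prop)) ?_ (integrable_const _) ?_
  · exact this.2.differentiableAt
  · filter_upwards [supp_ae hsupp] with x hx w hw
    have h1 := h x hx
    rw [Metric.mem_ball, dist_eq_norm] at hw
    have h2 : ‖z - x‖ ≤ ‖w - x‖ + ‖w - z‖ := by
      have := norm_sub_le (w - x) (w - z)
      simpa using this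
    rw [norm_div, norm_pow, norm_neg, norm_one, one_div]
    apply inv_anti₀ (by positivity)
    gcongr; linarith
  · filter_upwards [supp_ae hsupp] with x hx w hw
    have h1 := h x hx
    rw [Metric.mem_ball, dist_eq_norm] at hw
    have h2 : ‖z - x‖ ≤ ‖w - x‖ + ‖w - z‖ := by
      have := norm_sub_le (w - x) (w - z)
      simpa using this
    have : w - x ≠ 0 := by
      rw [← norm_pos_iff]; linarith
    exact ((hasDerivAt_id w).sub_const _).inv this

lemma cG_conj (μ : Measure ℝ) (z : ℂ) : cG μ (starRingEnd ℂ z) = starRingEnd ℂ (cG μ z) := by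
  unfold cG
  rw [← integral_conj]
  simp

lemma cG_im {μ : Measure ℝ} [IsProbabilityMeasure μ] (hsupp : μ (Set.Icc (-2 : ℝ) 2)ᶜ = 0)
   {z : ℂ} (hz : z ∈ cU) : ∃ P > 0, (cG μ z).im = - z.im * P := by
  refine ⟨∫ x : ℝ, (normSq (z - x))⁻¹ ∂μ, ?_, ?_⟩
  · obtain ⟨δ, hδ, h⟩ := cU_dist hz
    have hi : Integrable (fun x : ℝ => (normSq (z - x))⁻¹) μ := by
      refine Integrable.of_bound (Measurable.aestronglyMeasurable (by fun_prop)) ((δ^2)⁻¹) ?_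
      filter_upwards [supp_ae hsupp] with x hx
      rw [norm_inv, normSq_eq_norm_sq, norm_pow, norm_norm]
      have := h x hx
      gcongr
    refine int_pos hsupp hi fun x hx => inv_pos.2 (normSq_pos.2 (sub_ne_zero.2 (hz x hx)))
  · rw [cG, ← integral_const_mul]
    have : ((∫ x : ℝ, (z - (x : ℂ))⁻¹ ∂μ)).im = ∫ x : ℝ, ((z - (x : ℂ))⁻¹).im ∂μ :=
      (integral_im (cG_int hsupp hz)).symm
    rw [this]
    congr 1; ext x
    simp [inv_im, div_eq_mul_inv]

lemma cU_real {x : ℝ} (hx : (x:ℂ) ∈ cU) : 2 < x ∨ x < -2 := by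
  by_contra! h
  exact hx x ⟨by linarith, by linarith⟩ rfl

lemma cG_re {μ : Measure ℝ} [IsProbabilityMeasure μ] (hsupp : μ (Set.Icc (-2 : ℝ) 2)ᶜ = 0)
   {x : ℝ} (hz : (x:ℂ) ∈ cU) : Integrable (fun t : ℝ => (x - t)⁻¹) μ ∧
      (cG μ x).re = ∫ t : ℝ, (x - t)⁻¹ ∂μ := by
  have h := cG_int hsupp hz
  have e : (fun t : ℝ => ((x:ℂ) - (t : ℂ))⁻¹) = fun t : ℝ => (((x - t)⁻¹ : ℝ) : ℂ) := by
    ext t; push_cast; rfl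
  refine ⟨?_, ?_⟩
  · rw [e] at h
    exact h.re
  · rw [cG, e, integral_complex_ofReal]; simp

lemma cG_sign {μ : Measure ℝ} [IsProbabilityMeasure μ] (hsupp : μ (Set.Icc (-2 : ℝ) 2)ᶜ = 0)
   {x : ℝ} (hz : (x:ℂ) ∈ cU) : (2 < x → 0 < (cG μ x).re) ∧ (x < -2 → (cG μ x).re < 0) := by
  obtain ⟨hi, he⟩ := cG_re hsupp hz
  rw [he]
  constructor
  · intro h
    exact int_pos hsupp hi fun t ht => inv_pos.2 (by linarith [ht.2])
  · intro h
    have := int_pos hsupp hi.neg fun t ht => by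
      simpa using (show x < t by linarith [ht.1])
    simp only [Pi.neg_apply, integral_neg] at this
    linarith

lemma cG_mono {μ : Measure ℝ} [IsProbabilityMeasure μ] (hsupp : μ (Set.Icc (-2 : ℝ) 2)ᶜ = 0)
   {x y : ℝ} (hx : (x:ℂ) ∈ cU) (hy : (y:ℂ) ∈ cU) (h : x < y) (hs : 2 < x ∨ y < -2) :
    (cG μ y).re < (cG μ x).re := by
  obtain ⟨hi, he⟩ := cG_re hsupp hx
  obtain ⟨hi', he'⟩ := cG_re hsupp hy
  rw [he, he', ← sub_pos, ← integral_sub hi hi']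
  refine int_pos hsupp (hi.sub hi') fun t ht => ?_
  rw [sub_pos]
  rcases hs with hs | hs
  · exact inv_strictAnti₀ (by linarith [ht.2]) (by linarith)
  · exact (inv_lt_inv_of_neg (by linarith [ht.1]) (by linarith [ht.1])).2 (by linarith)

lemma cG_ne {μ : Measure ℝ} [IsProbabilityMeasure μ] (hsupp : μ (Set.Icc (-2 : ℝ) 2)ᶜ = 0)
   {z : ℂ} (hz : z ∈ cU) : cG μ z ≠ 0 := by
  intro h
  by_cases h0 : z.im = 0
  · obtain ⟨x, rfl⟩ : ∃ x : ℝ, (x:ℂ) = z := ⟨z.re, by apply Complex.ext <;> simp [h0]⟩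
    have := cG_sign hsupp hz
    rw [h] at this
    rcases cU_real hz with h1 | h1
    · simpa using this.1 h1
    · simpa using this.2 h1
  · obtain ⟨P, hP, e⟩ := cG_im hsupp hz
    rw [h] at e
    simp [h0, hP.ne'] at e

lemma cG_inj {μ : Measure ℝ} [IsProbabilityMeasure μ] (hsupp : μ (Set.Icc (-2 : ℝ) 2)ᶜ = 0)
    (huniv : Set.InjOn (fun z : ℂ => (∫ x : ℝ, (z - (x : ℂ))⁻¹ ∂μ)⁻¹)
      {z : ℂ | 0 < z.im}) : InjOn (cG μ) cU := by
  intro z hz w hw h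
  obtain ⟨P, hP, e⟩ := cG_im hsupp hz
  obtain ⟨Q, hQ, e'⟩ := cG_im hsupp hw
  have hh : z.im * P = w.im * Q := by rw [h] at e; linarith
  rcases lt_trichotomy z.im 0 with h0 | h0 | h0
  · have h1 : w.im < 0 := by
      by_contra! h1
      nlinarith [mul_nonneg h1 hQ.le, mul_pos_of_neg_of_neg h0 (neg_neg_of_pos hP)]
    have := @huniv (starRingEnd ℂ z) (by simpa using h0) (starRingEnd ℂ w) (by simpa using h1) (by
      change (cG μ _)⁻¹ = (cG μ _)⁻¹
      rw [cG_conj, cG_conj, h])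
    exact (starRingEnd ℂ).injective this
  · have h1 : w.im = 0 := by
      rw [h0] at hh
      simpa [hQ.ne'] using hh.symm
    obtain ⟨x, rfl⟩ : ∃ x : ℝ, (x:ℂ) = z := ⟨z.re, by apply Complex.ext <;> simp [h0]⟩
    obtain ⟨y, rfl⟩ : ∃ x : ℝ, (x:ℂ) = w := ⟨w.re, by apply Complex.ext <;> simp [h1]⟩
    have s1 := cG_sign hsupp hz
    have s2 := cG_sign hsupp hw
    rw [h] at s1
    have hxy : (2 < x ∧ 2 < y) ∨ (x < -2 ∧ y < -2) := by
      rcases cU_real hz with h1 | h1 <;> rcases cU_real hw with h2 | h2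
      · exact Or.inl ⟨h1, h2⟩
      · linarith [s1.1 h1, s2.2 h2]
      · linarith [s1.2 h1, s2.1 h2]
      · exact Or.inr ⟨h1, h2⟩
    rcases lt_trichotomy x y with h3 | h3 | h3
    · have := cG_mono hsupp hz hw h3 (by tauto)
      rw [h] at this; exact absurd this (lt_irrefl _)
    · rw [h3]
    · have := cG_mono hsupp hw hz h3 (by tauto)
      rw [h] at this; exact absurd this (lt_irrefl _)
  · have h1 : 0 < w.im := by
      by_contra! h1
      nlinarith [mul_nonneg (neg_nonneg.2 h1) hQ.le, mul_pos h0 hP]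
    exact huniv h0 h1 (by
      change (cG μ _)⁻¹ = (cG μ _)⁻¹
      rw [h])

lemma psi_mem {ζ : ℂ} (h : 1 < ‖ζ‖) : ζ + ζ⁻¹ ∈ cU := by
  intro x hx he
  have hn : 1 < normSq ζ := by rw [normSq_eq_norm_sq]; nlinarith
  have him := congrArg Complex.im he
  have hre := congrArg Complex.re he
  simp only [add_im, inv_im, ofReal_im, add_re, inv_re, ofReal_re] at him hre
  have h0 : ζ.im = 0 := by
    have : ζ.im * (normSq ζ - 1) = 0 := by
      field_simp at him; linarith
    rcases mul_eq_zero.1 this with h | h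
    · exact h
    · linarith
  have hs : normSq ζ = ζ.re ^ 2 := by rw [normSq_apply, h0]; ring
  rw [hs] at hre hn
  have h1 : ζ.re ≠ 0 := by rintro h; rw [h] at hn; norm_num at hn
  have h2 : ζ.re ^ 2 + 1 = x * ζ.re := by field_simp at hre; linarith
  have h3 : x ^ 2 ≤ 4 := by nlinarith [hx.1, hx.2]
  have h4 : (ζ.re ^ 2 + 1)^2 ≤ 4 * ζ.re^2 := by rw [h2, mul_pow]; gcongr
  nlinarith

lemma psi_inj : InjOn (fun ζ : ℂ => ζ + ζ⁻¹) {ζ | 1 < ‖ζ‖} := by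
  intro z hz w hw h
  simp only [mem_ofPred_eq] at hz hw h
  have z0 : z ≠ 0 := by rw [← norm_pos_iff]; linarith
  have w0 : w ≠ 0 := by rw [← norm_pos_iff]; linarith
  have : (z - w) * (z * w - 1) = 0 := by
    field_simp at h
    linear_combination h
  rcases mul_eq_zero.1 this with h | h
  · exact sub_eq_zero.1 h
  · have : ‖z‖ * ‖w‖ = 1 := by rw [← norm_mul, sub_eq_zero.1 h]; simp
    nlinarith

/-- asymptotics of the Cauchy transform -/
lemma cG_asymp {μ : Measure ℝ} [IsProbabilityMeasure μ] (hsupp : μ (Set.Icc (-2 : ℝ) 2)ᶜ = 0)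
    {z : ℂ} (hz : 4 ≤ ‖z‖) : ∃ e : ℂ, ‖e‖ ≤ 16 ∧
      cG μ z = z⁻¹ + (∫ x : ℝ, x ∂μ : ℝ) * z⁻¹^2 + (∫ x : ℝ, x^2 ∂μ : ℝ) * z⁻¹^3 + e * z⁻¹^4 := by
  have z0 : z ≠ 0 := by rw [← norm_pos_iff]; linarith
  have hlow : ∀ x ∈ Icc (-2:ℝ) 2, ‖z‖ / 2 ≤ ‖z - x‖ := by
    intro x hx
    have h1 := norm_sub_norm_le z x
    have h2 : ‖(x:ℂ)‖ ≤ 2 := by rw [norm_real]; exact abs_le.2 hx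
    linarith
  have hU : z ∈ cU := by
    intro x hx h
    have := hlow x hx
    rw [h, sub_self, norm_zero, ← h] at this
    linarith
  have hb : ∀ᵐ x : ℝ ∂μ, ‖(x:ℂ)^3 * z * (z - x)⁻¹‖ ≤ 16 := by
    filter_upwards [supp_ae hsupp] with x hx
    have h2 : ‖(x:ℂ)‖ ≤ 2 := by rw [norm_real]; exact abs_le.2 hx
    have h3 := hlow x hx
    rw [norm_mul, norm_mul, norm_inv, norm_pow, ← div_eq_mul_inv, div_le_iff₀ (by linarith)]
    have : ‖(x:ℂ)‖^3 ≤ 2^3 := by gcongr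
    nlinarith [norm_nonneg z]
  have i1 : Integrable (fun x : ℝ => x) μ := by
    refine Integrable.of_bound (by fun_prop) 2 ?_
    filter_upwards [supp_ae hsupp] with x hx using abs_le.2 hx
  have i2 : Integrable (fun x : ℝ => x^2) μ := by
    refine Integrable.of_bound (by fun_prop) 4 ?_
    filter_upwards [supp_ae hsupp] with x hx
    rw [norm_pow, Real.norm_eq_abs, sq_abs]; nlinarith [hx.1, hx.2]
  have i3 : Integrable (fun x : ℝ => (x:ℂ)^3 * z * (z - x)⁻¹) μ :=
    Integrable.of_bound (Measurable.aestronglyMeasurable (by fun_prop)) 16 hb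
  refine ⟨∫ x : ℝ, (x:ℂ)^3 * z * (z - x)⁻¹ ∂μ, ?_, ?_⟩
  · simpa using norm_integral_le_of_norm_le_const hb
  · have e : cG μ z = ∫ x : ℝ, (z⁻¹ + ((x : ℝ) : ℂ) * z⁻¹^2 + ((x^2 : ℝ):ℂ) * z⁻¹^3 
        + (x:ℂ)^3 * z * (z - x)⁻¹ * z⁻¹^4) ∂μ := by
      apply integral_congr_ae
      filter_upwards [supp_ae hsupp] with x hx
      have : z - x ≠ 0 := sub_ne_zero.2 (hU x hx)
      push_cast
      field_simp
      ring
    have j1 : Integrable (fun x : ℝ => ((x : ℝ) : ℂ) * z⁻¹^2) μ := (i1.ofReal).mul_const _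
    have j2 : Integrable (fun x : ℝ => ((x^2 : ℝ) : ℂ) * z⁻¹^3) μ := (i2.ofReal (𝕜 := ℂ)).mul_const _
    have j3 := i3.mul_const (z⁻¹^4)
    have k1 : Integrable (fun x : ℝ => z⁻¹ + ((x : ℝ) : ℂ) * z⁻¹^2) μ := (integrable_const _).add j1
    have k2 : Integrable (fun x : ℝ => z⁻¹ + ((x : ℝ) : ℂ) * z⁻¹^2 + ((x^2 : ℝ):ℂ) * z⁻¹^3) μ :=
      k1.add j2
    rw [e, integral_add k2 j3, integral_add k1 j2, integral_add (integrable_const _) j1,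
      integral_mul_const, integral_mul_const, integral_mul_const,
      integral_complex_ofReal, integral_complex_ofReal]
    simp


lemma circ_zero {F : ℂ → ℂ} (hF : DifferentiableOn ℂ F {ζ | 1 < ‖ζ‖}) {C K : ℝ}
    (hb : ∀ ζ : ℂ, K ≤ ‖ζ‖ → ‖F ζ‖ ≤ C / ‖ζ‖^2) {t : ℝ} (ht : 1 < t) :
    (∮ ζ in C(0, t), F ζ) = 0 := by
  have hopen : IsOpen {ζ : ℂ | 1 < ‖ζ‖} := isOpen_lt continuous_const continuous_norm
  have key : ∀ᶠ R : ℝ in Filter.atTop, ‖∮ ζ in C(0, t), F ζ‖ ≤ (2 * π * C) / R := by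
    filter_upwards [Filter.eventually_ge_atTop t, Filter.eventually_ge_atTop K] with R hR hK
    have e := circleIntegral_eq_of_differentiable_on_annulus_off_countable (c := 0) (r := t)
      (R := R) (by linarith) hR (f := F) (s := ∅) countable_empty ?_ ?_
    · rw [← e]
      have hR0 : 0 < R := by linarith
      have := circleIntegral.norm_integral_le_of_norm_le_const (f := F) (c := 0) (R := R)
        (C := C / R^2) hR0.le (fun z hz => by
          have : ‖z‖ = R := by simpa using hz
          have h2 := hb z (by linarith)
          rwa [this] at h2)
      refine this.trans (le_of_eq ?_)
      field_simp
    · apply hF.continuousOn.mono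
      intro z hz
      have : t ≤ ‖z‖ := by simpa using hz.2
      exact lt_of_lt_of_le ht this
    · intro z hz
      have : t < ‖z‖ := by simpa using hz.1.2
      exact hF.differentiableAt (hopen.mem_nhds (lt_trans ht this))
  have lim : Filter.Tendsto (fun R : ℝ => (2 * π * C) / R) Filter.atTop (nhds 0) :=
    Filter.Tendsto.div_atTop tendsto_const_nhds Filter.tendsto_id
  have := ge_of_tendsto lim key
  simpa using this

lemma deriv_decay {H : ℂ → ℂ} (hF : DifferentiableOn ℂ H {ζ | 1 < ‖ζ‖}) {C K : ℝ}
    (hb : ∀ ζ : ℂ, K ≤ ‖ζ‖ → ‖H ζ‖ ≤ C / ‖ζ‖^2) (ζ : ℂ) (h : max (2*K) 4 ≤ ‖ζ‖) :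
    ‖deriv H ζ‖ ≤ (8 * C) / ‖ζ‖^3 := by
  have h1 : 2 * K ≤ ‖ζ‖ := (le_max_left _ _).trans h
  have h2 : 4 ≤ ‖ζ‖ := (le_max_right _ _).trans h
  have hp : 0 < ‖ζ‖ := by linarith
  have hlow : ∀ z ∈ Metric.closedBall ζ (‖ζ‖/2), ‖ζ‖/2 ≤ ‖z‖ := by
    intro z hz
    rw [Metric.mem_closedBall, dist_eq_norm] at hz
    have := norm_sub_norm_le ζ z
    rw [norm_sub_rev] at this
    linarith
  have hC : 0 ≤ C := by
    have := (norm_nonneg _).trans (hb ζ (by linarith))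
    by_contra! hc
    have := div_neg_of_neg_of_pos hc (pow_pos hp 2)
    linarith
  have := Complex.norm_deriv_le_of_forall_mem_sphere_norm_le (c := ζ) (R := ‖ζ‖/2) (f := H)
    (C := C / (‖ζ‖/2)^2) (by positivity) ?_ ?_
  · refine this.trans (le_of_eq ?_)
    field_simp; norm_num
  · apply DifferentiableOn.diffContOnCl
    apply hF.mono
    intro z hz
    have := hlow z (Metric.closure_ball_subset_closedBall hz)
    show 1 < ‖z‖
    linarith
  · intro z hz
    have h3 := hlow z (Metric.sphere_subset_closedBall hz)
    refine (hb z (by linarith)).trans ?_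
    gcongr

lemma circle_bound {g : ℂ → ℂ} (hg : DifferentiableOn ℂ g {ζ | 1 < ‖ζ‖}) {b C K : ℝ}
    (hb : ∀ ζ : ℂ, K ≤ ‖ζ‖ → ‖g ζ - ζ - b / ζ‖ ≤ C / ‖ζ‖^2) {t : ℝ} (ht : 1 < t) :
    2 * π * (1 + b^2 / t^4) ≤ ∫ θ in (-π)..π, ‖deriv g (circleMap 0 t θ)‖^2 := by
  have hopen : IsOpen {ζ : ℂ | 1 < ‖ζ‖} := isOpen_lt continuous_const continuous_norm
  set H : ℂ → ℂ := fun ζ => g ζ - ζ - b / ζ with hH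
  have hne : ∀ ζ : ℂ, 1 < ‖ζ‖ → ζ ≠ 0 := fun ζ h => by rw [← norm_pos_iff]; linarith
  have hHd : DifferentiableOn ℂ H {ζ | 1 < ‖ζ‖} := by
    apply (hg.sub differentiableOn_id).sub
    exact (differentiableOn_const _).div differentiableOn_id hne
  have hH' := hHd.deriv hopen
  have hder : ∀ ζ : ℂ, 1 < ‖ζ‖ → deriv g ζ = 1 - b / ζ^2 + deriv H ζ := by
    intro ζ h
    have h0 := hne ζ h
    have hg1 := (hg.differentiableAt (hopen.mem_nhds h)).hasDerivAt
    have h3 : HasDerivAt H (deriv g ζ - 1 - b * (-(ζ^2)⁻¹)) ζ := by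
      have := (hg1.sub (hasDerivAt_id ζ)).sub ((hasDerivAt_inv h0).const_mul (b:ℂ))
      exact this
    rw [h3.deriv]
    field_simp; ring
  have hdec := deriv_decay hHd hb
  have c1 : (∮ ζ in C(0, t), deriv H ζ * ζ) = 0 := by
    apply circ_zero (hH'.mul differentiableOn_id) (C := 8 * C) (K := max (2*K) 4) _ ht
    intro ζ h
    have h2 : 4 ≤ ‖ζ‖ := (le_max_right _ _).trans h
    have := hdec ζ h
    simp only [Pi.mul_apply, id, norm_mul]
    calc ‖deriv H ζ‖ * ‖ζ‖ ≤ (8 * C) / ‖ζ‖^3 * ‖ζ‖ := by gcongr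
      _ = _ := by field_simp
  have c2 : (∮ ζ in C(0, t), deriv H ζ * ζ⁻¹) = 0 := by
    apply circ_zero (hH'.mul (differentiableOn_id.inv hne)) (C := 8 * C) (K := max (2*K) 4) _ ht
    intro ζ h
    have h2 : 4 ≤ ‖ζ‖ := (le_max_right _ _).trans h
    have := hdec ζ h
    have hC : 0 ≤ 8 * C / ‖ζ‖^2 := by
      have h3 : 0 ≤ (8 * C) / ‖ζ‖^3 * ‖ζ‖ := mul_nonneg ((norm_nonneg _).trans this) (norm_nonneg _)
      refine h3.trans (le_of_eq ?_)
      field_simp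
    simp only [Pi.mul_apply, Pi.inv_apply, id, norm_mul, norm_inv]
    calc ‖deriv H ζ‖ * ‖ζ‖⁻¹ ≤ (8 * C) / ‖ζ‖^3 * ‖ζ‖⁻¹ := by gcongr
      _ = 8 * C / ‖ζ‖^2 * (‖ζ‖^2)⁻¹ := by field_simp
      _ ≤ 8 * C / ‖ζ‖^2 * 1 := by
        gcongr
        apply inv_le_one_of_one_le₀
        nlinarith
      _ = _ := by ring
  have t0 : 0 < t := by linarith
  have hnt : ∀ θ, ‖circleMap 0 t θ‖ = t := fun θ => by simp [abs_of_pos t0]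
  -- angular integrals
  have ang : ∀ f : ℂ → ℂ, (∫ θ in (-π)..π, f (circleMap 0 t θ)) = -I * ∮ ζ in C(0, t), f ζ * ζ⁻¹ := by
    intro f
    have per : Function.Periodic (fun θ => f (circleMap 0 t θ)) (2 * π) := fun θ => by
      simp only [periodic_circleMap 0 t θ]
    have := per.intervalIntegral_add_eq (-π) 0
    rw [show -π + 2 * π = π by ring, zero_add] at this
    rw [this, circleIntegral, ← intervalIntegral.integral_const_mul]
    congr 1; ext θ
    have : circleMap 0 t θ ≠ 0 := hne _ (by rw [hnt]; exact ht)
    simp only [deriv_circleMap, smul_eq_mul]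
    field_simp
    simp
  have zp : ∀ n : ℤ, n ≠ -1 → (∮ ζ in C(0, t), ζ ^ n) = 0 := by
    intro n hn
    simpa using circleIntegral.integral_sub_zpow_of_ne hn 0 0 t
  have cH : ContinuousOn (deriv H) (Metric.sphere 0 t) := hH'.continuousOn.mono fun z hz => by
    have : ‖z‖ = t := by simpa using hz
    show 1 < ‖z‖
    linarith
  have cg : ContinuousOn (deriv g) (Metric.sphere 0 t) :=
    (hg.deriv hopen).continuousOn.mono fun z hz => by
      have : ‖z‖ = t := by simpa using hz
      show 1 < ‖z‖
      linarith
  have cinv : ContinuousOn (fun ζ : ℂ => ζ⁻¹) (Metric.sphere 0 t) := by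
    apply continuousOn_id.inv₀
    intro z hz
    exact hne z (by simpa [show ‖z‖ = t by simpa using hz] using ht)
  -- the comparison function
  let f : ℂ → ℂ := fun ζ => (1 + b^2/t^4) - b * (ζ⁻¹)^2 - b / t^4 * ζ^2
      + 2 * deriv H ζ - 2 * b / t^4 * (deriv H ζ * ζ^2)
  have cf : ContinuousOn f (Metric.sphere 0 t) := by
    simp only [f]
    fun_prop
  have intf : (∫ θ in (-π)..π, f (circleMap 0 t θ)) = 2 * π * (1 + b^2 / t^4) := by
    rw [ang]
    have e : (∮ ζ in C(0, t), f ζ * ζ⁻¹) = ∮ ζ in C(0,t), ((1 + b^2/t^4 : ℂ) * ζ⁻¹ - b * ζ^(-3:ℤ)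
       - (b / t^4 : ℂ) * ζ^(1:ℤ) + 2 * (deriv H ζ * ζ⁻¹) - (2 * b / t^4 : ℂ) * (deriv H ζ * ζ)) := by
      apply circleIntegral.integral_congr t0.le
      intro z hz
      have : z ≠ 0 := hne z (by simpa [show ‖z‖ = t by simpa using hz] using ht)
      have h3 : z ^ (-3:ℤ) = (z^3)⁻¹ := by rw [zpow_neg]; norm_cast
      simp only [f, h3, zpow_one]
      field_simp
    have i1 : CircleIntegrable (fun ζ : ℂ => (1 + b^2/t^4 : ℂ) * ζ⁻¹) 0 t :=
      ContinuousOn.circleIntegrable t0.le (by fun_prop)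
    have h3 : ∀ z : ℂ, z ^ (-3:ℤ) = (z⁻¹)^3 := fun z => by rw [zpow_neg, inv_pow]; norm_cast
    have i2 : CircleIntegrable (fun ζ : ℂ => (b:ℂ) * ζ^(-3:ℤ)) 0 t := by
      simp only [h3]
      exact ContinuousOn.circleIntegrable t0.le (by fun_prop)
    have i3 : CircleIntegrable (fun ζ : ℂ => (b / t^4:ℂ) * ζ^(1:ℤ)) 0 t := by
      simp only [zpow_one]
      exact ContinuousOn.circleIntegrable t0.le (by fun_prop)
    have i4 : CircleIntegrable (fun ζ : ℂ => 2 * (deriv H ζ * ζ⁻¹)) 0 t :=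
      ContinuousOn.circleIntegrable t0.le (by fun_prop)
    have i5 : CircleIntegrable (fun ζ : ℂ => (2 * b / t^4 : ℂ) * (deriv H ζ * ζ)) 0 t :=
      ContinuousOn.circleIntegrable t0.le (by fun_prop)
    have j2 : CircleIntegrable (fun ζ : ℂ => (1 + b^2/t^4 : ℂ) * ζ⁻¹ - (b:ℂ) * ζ^(-3:ℤ)) 0 t := i1.sub i2
    have j3 : CircleIntegrable (fun ζ : ℂ => (1 + b^2/t^4 : ℂ) * ζ⁻¹ - (b:ℂ) * ζ^(-3:ℤ)
      - (b / t^4 : ℂ) * ζ^(1:ℤ)) 0 t := j2.sub i3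
    have j4 : CircleIntegrable (fun ζ : ℂ => (1 + b^2/t^4 : ℂ) * ζ⁻¹ - (b:ℂ) * ζ^(-3:ℤ)
      - (b / t^4 : ℂ) * ζ^(1:ℤ) + 2 * (deriv H ζ * ζ⁻¹)) 0 t := j3.add i4
    rw [e, circleIntegral.integral_sub j4 i5, circleIntegral.integral_add j3 i4,
      circleIntegral.integral_sub j2 i3, circleIntegral.integral_sub i1 i2]
    simp only [circleIntegral.integral_const_mul]
    rw [c1, c2, zp _ (by norm_num), zp _ (by norm_num)]
    have := circleIntegral.integral_sub_center_inv 0 t0.ne'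
    simp only [sub_zero] at this
    rw [this]
    linear_combination (-(1 + (b:ℂ)^2/t^4) * (2 * π)) * I_sq
  have cc : ∀ θ, circleMap 0 t θ ∈ Metric.sphere (0:ℂ) t := fun θ => by simp [abs_of_pos t0]
  have cfc : Continuous fun θ => f (circleMap 0 t θ) :=
    cf.comp_continuous (continuous_circleMap 0 t) cc
  have cgc : Continuous fun θ => deriv g (circleMap 0 t θ) :=
    cg.comp_continuous (continuous_circleMap 0 t) cc
  have re : (∫ θ in (-π)..π, (f (circleMap 0 t θ)).re) = 2 * π * (1 + b^2 / t^4) := by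
    have h := Complex.reCLM.intervalIntegral_comp_comm (cfc.intervalIntegrable (μ := volume) (-π) π)
    simp only [reCLM_apply] at h
    rw [h, intf]
    have : (2 * π * (1 + b^2 / t^4) : ℂ) = ((2 * π * (1 + b^2 / t^4) : ℝ) : ℂ) := by push_cast; rfl
    rw [this, ofReal_re]
  rw [← re]
  apply intervalIntegral.integral_mono_on (by linarith [pi_pos])
  · exact (Continuous.intervalIntegrable (continuous_re.comp cfc) _ _)
  · exact (Continuous.intervalIntegrable (by fun_prop) _ _)
  · intro θ _
    set ζ := circleMap 0 t θ
    have hz : ‖ζ‖ = t := hnt θ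
    have h0 : ζ ≠ 0 := hne ζ (by linarith)
    have hconj : starRingEnd ℂ ζ = t^2 / ζ := by
      rw [eq_div_iff h0, mul_comm, mul_conj, normSq_eq_norm_sq, hz]; push_cast; rfl
    rw [hder ζ (by linarith)]
    set p : ℂ := 1 - b / ζ^2
    set h := deriv H ζ
    have hp : starRingEnd ℂ p = 1 - b * ζ^2 / t^4 := by
      simp only [p, map_sub, map_one, map_div₀, map_pow, conj_ofReal, hconj]
      have : (t:ℂ) ≠ 0 := by exact_mod_cast t0.ne'
      field_simp
    have hf : f ζ = p * starRingEnd ℂ p + 2 * (starRingEnd ℂ p * h) := by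
      rw [hp]; simp only [f, p]
      have : (t:ℂ) ≠ 0 := by exact_mod_cast t0.ne'
      field_simp
      ring
    rw [hf, mul_conj, ← normSq_eq_norm_sq, normSq_add]
    simp only [add_re, ofReal_re, mul_re, conj_re, conj_im, re_ofNat, im_ofNat]
    nlinarith [normSq_nonneg h]

lemma det_smul_one (c : ℂ) : (c • (1 : ℂ →L[ℝ] ℂ)).det = ‖c‖^2 := by
  rw [ContinuousLinearMap.det, ← LinearMap.det_toMatrix basisOneI, Matrix.det_fin_two]
  simp [LinearMap.toMatrix_apply, ← normSq_eq_norm_sq, normSq_apply]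

noncomputable def mapM (c : ℝ) : ℂ →ₗ[ℝ] ℂ := LinearMap.id - c • conjAe.toLinearMap

lemma mapM_apply (c : ℝ) (w : ℂ) : mapM c w = w - c * starRingEnd ℂ w := by
  simp [mapM]

lemma det_mapM (c : ℝ) : LinearMap.det (mapM c) = 1 - c^2 := by
  rw [← LinearMap.det_toMatrix basisOneI, Matrix.det_fin_two]
  simp [LinearMap.toMatrix_apply, mapM_apply]
  ring

lemma area_lower {g : ℂ → ℂ} (hg : DifferentiableOn ℂ g {ζ | 1 < ‖ζ‖})
    (hinj : InjOn g {ζ | 1 < ‖ζ‖}) {b C K : ℝ}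
    (hb : ∀ ζ : ℂ, K ≤ ‖ζ‖ → ‖g ζ - ζ - b / ζ‖ ≤ C / ‖ζ‖^2) {r R : ℝ} (hr : 1 < r) (hrR : r < R) :
    ENNReal.ofReal (π * (R^2 - r^2 + b^2/r^2 - b^2/R^2)) ≤
      volume (g '' {ζ | r < ‖ζ‖ ∧ ‖ζ‖ < R}) := by
  have hopen : IsOpen {ζ : ℂ | 1 < ‖ζ‖} := isOpen_lt continuous_const continuous_norm
  set A : Set ℂ := {ζ | r < ‖ζ‖ ∧ ‖ζ‖ < R}
  have hA : IsOpen A := (isOpen_lt continuous_const continuous_norm).inter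
    (isOpen_lt continuous_norm continuous_const)
  have hsub : A ⊆ {ζ | 1 < ‖ζ‖} := fun z hz => lt_trans hr hz.1
  rw [← lintegral_abs_det_fderiv_eq_addHaar_image volume hA.measurableSet
    (f' := fun z => deriv g z • (1 : ℂ →L[ℝ] ℂ))
    (fun z hz => ((hg.differentiableAt (hopen.mem_nhds (hsub hz))).hasDerivAt.complexToReal_fderiv).hasFDerivWithinAt)
    (hinj.mono hsub)]
  simp only [det_smul_one, abs_pow, abs_norm]
  rw [← lintegral_indicator hA.measurableSet, ← Complex.lintegral_comp_polarCoord_symm]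
  have hsub2 : Ioo r R ×ˢ Ioo (-π) π ⊆ polarCoord.target := by
    rintro ⟨t, θ⟩ ⟨h1, h2⟩
    simp only [polarCoord_target, mem_prod]
    exact ⟨by simp only [mem_Ioi]; linarith [h1.1], h2⟩
  have hm : MeasurableSet (Ioo r R ×ˢ Ioo (-π) π) := measurableSet_Ioo.prod measurableSet_Ioo
  refine le_trans ?_ (lintegral_mono_set hsub2)
  have e : (∫⁻ p in Ioo r R ×ˢ Ioo (-π) π, ENNReal.ofReal p.1 •
      A.indicator (fun a => ENNReal.ofReal (‖deriv g a‖^2)) (Complex.polarCoord.symm p)) =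
      ∫⁻ p in Ioo r R ×ˢ Ioo (-π) π,
        ENNReal.ofReal p.1 * ENNReal.ofReal (‖deriv g (circleMap 0 p.1 p.2)‖^2) := by
    apply setLIntegral_congr_fun hm
    rintro ⟨t, θ⟩ ⟨h1, h2⟩
    have hc : Complex.polarCoord.symm (t, θ) = circleMap 0 t θ := by
      simp [Complex.polarCoord_symm_apply, circleMap, Complex.exp_mul_I]
    have hmem : circleMap 0 t θ ∈ A := by
      have : ‖circleMap 0 t θ‖ = t := by simp; linarith [h1.1]
      simp only [A, mem_ofPred_eq, this]
      exact h1
    simp only [hc, indicator_of_mem hmem, smul_eq_mul]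
  rw [e, Measure.volume_eq_prod, ← Measure.prod_restrict, lintegral_prod]
  swap
  · apply Measurable.aemeasurable
    have h1 : Measurable fun p : ℝ × ℝ => circleMap 0 p.1 p.2 := by
      unfold circleMap; fun_prop
    have h2 : Measurable fun p : ℝ × ℝ => deriv g (circleMap 0 p.1 p.2) :=
      (measurable_deriv g).comp h1
    fun_prop
  have inner : ∀ t ∈ Ioo r R, ENNReal.ofReal (t * (2 * π * (1 + b^2/t^4))) ≤
      ∫⁻ θ in Ioo (-π) π, ENNReal.ofReal t * ENNReal.ofReal (‖deriv g (circleMap 0 t θ)‖^2) := by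
    intro t ht
    have ht1 : 1 < t := lt_trans hr ht.1
    have t0 : 0 < t := by linarith
    have cgc : Continuous fun θ => deriv g (circleMap 0 t θ) :=
      (hg.deriv hopen).continuousOn.comp_continuous (continuous_circleMap 0 t) fun θ => by
        simp [abs_of_pos t0, ht1]
    rw [lintegral_const_mul' _ _ ENNReal.ofReal_ne_top, ENNReal.ofReal_mul t0.le]
    gcongr
    rw [← ofReal_integral_eq_lintegral_ofReal]
    · apply ENNReal.ofReal_le_ofReal
      rw [← integral_Ioc_eq_integral_Ioo, ← intervalIntegral.integral_of_le (by linarith [pi_pos])]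
      exact circle_bound hg hb ht1
    · have : Continuous fun θ => ‖deriv g (circleMap 0 t θ)‖^2 := by fun_prop
      exact (this.integrableOn_Icc (a := -π) (b := π)).mono_set Ioo_subset_Icc_self
    · exact Filter.Eventually.of_forall fun θ => by positivity
  refine le_trans ?_ (setLIntegral_mono' measurableSet_Ioo inner)
  have hint : IntervalIntegrable (fun t : ℝ => t * (2 * π * (1 + b^2/t^4))) volume r R := by
    apply ContinuousOn.intervalIntegrable
    rw [uIcc_of_le hrR.le]
    apply ContinuousOn.mul continuousOn_id
    apply ContinuousOn.mul continuousOn_const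
    apply ContinuousOn.add continuousOn_const
    apply ContinuousOn.div continuousOn_const (by fun_prop)
    intro t ht
    have : 0 < t := by linarith [ht.1]
    positivity
  rw [← ofReal_integral_eq_lintegral_ofReal]
  · apply ENNReal.ofReal_le_ofReal
    rw [← integral_Ioc_eq_integral_Ioo, ← intervalIntegral.integral_of_le hrR.le]
    have := intervalIntegral.integral_eq_sub_of_hasDerivAt (a := r) (b := R)
      (f := fun t : ℝ => π * (t^2 - b^2 * (t^2)⁻¹)) (f' := fun t : ℝ => t * (2 * π * (1 + b^2/t^4)))
      (fun t ht => by
        rw [uIcc_of_le hrR.le] at ht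
        have t0 : t ≠ 0 := by linarith [ht.1]
        have h1 := hasDerivAt_pow 2 t
        have h2 := (((h1.sub ((h1.inv (pow_ne_zero 2 t0)).const_mul (b^2)))).const_mul π)
        refine HasDerivAt.congr_deriv h2 ?_
        simp only [Nat.cast_ofNat]
        field_simp
        ring) hint
    rw [this]
    apply le_of_eq
    ring
  · rw [intervalIntegrable_iff_integrableOn_Ioo_of_le hrR.le] at hint
    exact hint
  · filter_upwards [self_mem_ae_restrict measurableSet_Ioo] with t ht
    have : 0 < t := by linarith [ht.1]
    simp only [Pi.zero_apply]
    positivity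

lemma area_contain {g : ℂ → ℂ} (hg : DifferentiableOn ℂ g {ζ | 1 < ‖ζ‖}) {b C K : ℝ}
    (hb : ∀ ζ : ℂ, K ≤ ‖ζ‖ → ‖g ζ - ζ - b / ζ‖ ≤ C / ‖ζ‖^2) {r : ℝ} (hr : 1 < r) :
    ∀ᶠ R in Filter.atTop, ∀ ζ : ℂ, r < ‖ζ‖ → ‖ζ‖ < R →
      ‖mapM (b/R^2) (g ζ)‖ ≤ R + 8 * C / R^2 := by
  have hC : 0 ≤ C := by
    have h1 : ‖((max K 1 : ℝ) : ℂ)‖ = max K 1 := by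
      rw [norm_real]; exact abs_of_pos (by positivity)
    have := (norm_nonneg _).trans (hb ((max K 1 : ℝ) : ℂ) (by rw [h1]; exact le_max_left _ _))
    rw [h1] at this
    by_contra! hc
    have := div_neg_of_neg_of_pos hc (show 0 < (max K 1)^2 by positivity)
    linarith
  obtain ⟨D, hD⟩ : ∃ D, ∀ ζ : ℂ, r < ‖ζ‖ → ‖g ζ‖ ≤ ‖ζ‖ + D := by
    have hcomp : IsCompact (Metric.closedBall (0:ℂ) K ∩ {ζ | r ≤ ‖ζ‖}) :=
      (isCompact_closedBall _ _).inter_right (isClosed_le continuous_const continuous_norm)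
    obtain ⟨B, hB⟩ := hcomp.exists_bound_of_continuousOn (f := g)
      (hg.continuousOn.mono fun z hz => lt_of_lt_of_le hr hz.2)
    refine ⟨max B (|b| + C), fun ζ h => ?_⟩
    by_cases hK : ‖ζ‖ ≤ K
    · have := hB ζ ⟨by simpa using hK, h.le⟩
      linarith [le_max_left B (|b| + C), norm_nonneg ζ]
    · have h1 := hb ζ (by linarith)
      have h2 : C / ‖ζ‖^2 ≤ C := div_le_self hC (by nlinarith)
      have h3 : ‖(b:ℂ) / ζ‖ ≤ |b| := by
        rw [norm_div, norm_real, Real.norm_eq_abs]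
        exact div_le_self (abs_nonneg _) (by linarith)
      have h4 : g ζ = (g ζ - ζ - b / ζ) + ζ + b / ζ := by ring
      have h5 : ‖g ζ‖ ≤ ‖g ζ - ζ - b / ζ‖ + ‖ζ‖ + ‖(b:ℂ) / ζ‖ := by
        conv_lhs => rw [h4]
        exact norm_add₃_le
      linarith [le_max_right B (|b| + C)]
  have ev : ∀ᶠ R : ℝ in Filter.atTop, 4 * |b| ≤ R^2 :=
    (Filter.tendsto_pow_atTop (α := ℝ) two_ne_zero).eventually_ge_atTop _
  filter_upwards [ev, Filter.eventually_ge_atTop (4 * D), Filter.eventually_ge_atTop (2 * K),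
    Filter.eventually_ge_atTop 1] with R hRb hRD hRK hR1 ζ h1 h2
  have R0 : 0 < R := by linarith
  have hc : |b / R^2| ≤ 1/4 := by
    rw [abs_div, abs_of_pos (show 0 < R^2 by positivity), div_le_iff₀ (by positivity)]
    linarith
  rw [mapM_apply]
  have hE : 0 ≤ 8 * C / R^2 := by positivity
  by_cases ht : ‖ζ‖ < R / 2
  · have h3 := hD ζ h1
    have h4 : ‖g ζ - ((b/R^2 : ℝ):ℂ) * starRingEnd ℂ (g ζ)‖ ≤ ‖g ζ‖ + |b/R^2| * ‖g ζ‖ := by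
      refine (norm_sub_le _ _).trans (le_of_eq ?_)
      rw [norm_mul, norm_real, RCLike.norm_conj, Real.norm_eq_abs]
    have h5 : |b/R^2| * ‖g ζ‖ ≤ 1/4 * ‖g ζ‖ := by gcongr
    linarith
  · push Not at ht
    set t := ‖ζ‖
    have t0 : 0 < t := by linarith
    have z0 : ζ ≠ 0 := norm_pos_iff.1 t0
    set H := g ζ - ζ - b / ζ with hH
    have hHb : ‖H‖ ≤ 4 * C / R^2 := by
      refine (hb ζ (by linarith)).trans ?_
      calc C / t^2 ≤ C / (R/2)^2 := by gcongr
        _ = _ := by field_simp; norm_num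
    set c := b / R^2
    set β := b / t^2
    have hinv : (b:ℂ) / ζ = β * starRingEnd ℂ ζ := by
      have : ζ * starRingEnd ℂ ζ = (t:ℂ)^2 := by
        rw [mul_conj, normSq_eq_norm_sq]; push_cast; rfl
      have ht' : (t:ℂ) ≠ 0 := by exact_mod_cast t0.ne'
      simp only [β]; push_cast
      field_simp
      linear_combination (-(b:ℂ)) * this
    have hgz : g ζ = ζ + β * starRingEnd ℂ ζ + H := by rw [hH, hinv]; ring
    have e : g ζ - c * starRingEnd ℂ (g ζ) = ((1 - c * β : ℝ):ℂ) * ζ + ((β - c : ℝ):ℂ) * starRingEnd ℂ ζ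
        + (H - c * starRingEnd ℂ H) := by
      rw [hgz]; simp only [map_add, map_mul, conj_ofReal, conj_conj]; push_cast; ring
    have hcb0 : 0 ≤ c * β := by
      have : c * β = b^2 / (R^2 * t^2) := by simp only [c, β]; field_simp
      rw [this]; positivity
    have hβ : |β| ≤ 1 := by
      rw [abs_div, abs_of_pos (show 0 < t^2 by positivity), div_le_iff₀ (by positivity)]
      nlinarith
    have hcb1 : c * β ≤ 1 := by
      have := le_abs_self (c * β)
      rw [abs_mul] at this
      nlinarith [abs_nonneg c, abs_nonneg β]
    have hbc : |β - c| * t ≤ R - t := by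
      have : β - c = b * ((R^2 - t^2) / (R^2 * t^2)) := by simp only [c, β]; field_simp
      rw [this, abs_mul, abs_of_nonneg (a := (R^2 - t^2) / (R^2 * t^2))
        (div_nonneg (by nlinarith) (by positivity))]
      have e2 : |b| * ((R ^ 2 - t ^ 2) / (R ^ 2 * t ^ 2)) * t = (R - t) * (|b| * (R + t) / (R^2 * t)) := by
        field_simp; ring
      rw [e2]
      have : |b| * (R + t) / (R^2 * t) ≤ 1 := by
        rw [div_le_one (by positivity)]
        nlinarith [abs_nonneg b]
      nlinarith
    have hl : ‖H - c * starRingEnd ℂ H‖ ≤ 8 * C / R^2 := by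
      have h4 : ‖H - c * starRingEnd ℂ H‖ ≤ ‖H‖ + |c| * ‖H‖ := by
        refine (norm_sub_le _ _).trans (le_of_eq ?_)
        rw [norm_mul, norm_real, RCLike.norm_conj, Real.norm_eq_abs]
      have h5 : |c| * ‖H‖ ≤ 1 * ‖H‖ := by gcongr; linarith
      have h6 : 8 * C / R^2 = 2 * (4 * C / R^2) := by ring
      linarith
    rw [e]
    refine norm_add₃_le.trans ?_
    rw [norm_mul, norm_mul, norm_real, norm_real, RCLike.norm_conj, Real.norm_eq_abs,
      Real.norm_eq_abs, abs_of_nonneg (show 0 ≤ 1 - c * β by linarith)]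
    nlinarith

theorem area_thm {g : ℂ → ℂ} (hg : DifferentiableOn ℂ g {ζ | 1 < ‖ζ‖})
    (hinj : InjOn g {ζ | 1 < ‖ζ‖}) {b C K : ℝ}
    (hb : ∀ ζ : ℂ, K ≤ ‖ζ‖ → ‖g ζ - ζ - b / ζ‖ ≤ C / ‖ζ‖^2) : |b| ≤ 1 := by
  have step : ∀ r : ℝ, 1 < r → b^2/r^2 - r^2 ≤ 0 := by
    intro r hr
    have hlim : ∀ᶠ R : ℝ in Filter.atTop, b^2/r^2 - r^2 ≤
        (2 * b^2 + b^2 * |b^2/r^2 - r^2| + 16 * |C| + 64 * C^2) / R := by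
      have ev : ∀ᶠ R : ℝ in Filter.atTop, 4 * |b| ≤ R^2 :=
        (Filter.tendsto_pow_atTop (α := ℝ) two_ne_zero).eventually_ge_atTop _
      have ev2 : ∀ᶠ R : ℝ in Filter.atTop, 8 * |C| ≤ R^2 :=
        (Filter.tendsto_pow_atTop (α := ℝ) two_ne_zero).eventually_ge_atTop _
      filter_upwards [area_contain hg hb hr, Filter.eventually_gt_atTop r, ev, ev2] with R hR hrR hRb hRC
      have R1 : 1 < R := by linarith
      have R0 : 0 < R := by linarith
      have low := area_lower hg hinj hb hr hrR
      set A : Set ℂ := {ζ | r < ‖ζ‖ ∧ ‖ζ‖ < R}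
      set X := b^2/r^2 - r^2 with hX
      have hin : mapM (b/R^2) '' (g '' A) ⊆ Metric.closedBall 0 (R + 8 * C / R^2) := by
        rintro _ ⟨_, ⟨ζ, hζ, rfl⟩, rfl⟩
        simpa using hR ζ hζ.1 hζ.2
      have hv := measure_mono (μ := volume) hin
      rw [Measure.addHaar_image_linearMap, det_mapM, Complex.volume_closedBall] at hv
      have hc : (b / R^2)^2 ≤ 1 := by
        rw [div_pow, div_le_one (by positivity)]
        rw [← sq_abs b]
        have : |b| ≤ R^2 := by nlinarith [abs_nonneg b]
        gcongr
      rw [abs_of_nonneg (by linarith)] at hv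
      have hρ : 0 ≤ R + 8 * C / R^2 := by
        have : -1 ≤ 8 * C / R^2 := by
          rw [le_div_iff₀ (by positivity)]; linarith [neg_abs_le C]
        linarith
      have h1 := (mul_le_mul_right low (ENNReal.ofReal (1 - (b/R^2)^2))).trans hv
      rw [← ENNReal.ofReal_mul (by linarith), ← ENNReal.ofReal_pow hρ,
        show (NNReal.pi : ENNReal) = ENNReal.ofReal π by
          rw [ENNReal.ofReal, ← NNReal.coe_real_pi, Real.toNNReal_coe], ← ENNReal.ofReal_mul (by positivity),
        ENNReal.ofReal_le_ofReal_iff (by positivity)] at h1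
      have h2 : (1 - (b/R^2)^2) * (R^2 + X - b^2/R^2) ≤ (R + 8 * C / R^2)^2 := by
        have hp := pi_pos
        rw [← mul_le_mul_iff_left₀ hp]
        refine le_trans (le_of_eq ?_) h1
        rw [hX]; ring
      have hexp : X ≤ 2 * b^2 * (1/R^2) + b^2 * X * (1/R^4) - b^4 * (1/R^6) + 16 * C * (1/R) + 64 * C^2 * (1/R^4) := by
        have e1 : (1 - (b/R^2)^2) * (R^2 + X - b^2/R^2) = R^2 + X - 2 * b^2 * (1/R^2) - b^2 * X * (1/R^4)
          + b^4 * (1/R^6) := by field_simp; ring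
        have e2 : (R + 8 * C / R^2)^2 = R^2 + 16 * C * (1/R) + 64 * C^2 * (1/R^4) := by
          field_simp; ring
        linarith
      have q2 : 1/R^2 ≤ 1/R := one_div_le_one_div_of_le R0 (le_self_pow₀ R1.le (by norm_num))
      have q4 : 1/R^4 ≤ 1/R := one_div_le_one_div_of_le R0 (le_self_pow₀ R1.le (by norm_num))
      have t1 : 2 * b^2 * (1/R^2) ≤ 2 * b^2 * (1/R) := by gcongr
      have t2 : b^2 * X * (1/R^4) ≤ b^2 * |X| * (1/R) := by gcongr; exact le_abs_self X
      have t3 : 0 ≤ b^4 * (1/R^6) := by positivity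
      have t4 : 16 * C * (1/R) ≤ 16 * |C| * (1/R) := by gcongr; exact le_abs_self C
      have t5 : 64 * C^2 * (1/R^4) ≤ 64 * C^2 * (1/R) := by gcongr
      have e3 : (2 * b^2 + b^2 * |X| + 16 * |C| + 64 * C^2) / R =
        2 * b^2 * (1/R) + b^2 * |X| * (1/R) + 16 * |C| * (1/R) + 64 * C^2 * (1/R) := by ring
      linarith
    refine ge_of_tendsto ?_ hlim
    exact Filter.Tendsto.div_atTop tendsto_const_nhds Filter.tendsto_id
  have step2 : ∀ r : ℝ, 1 < r → |b| ≤ r^2 := by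
    intro r hr
    have h := step r hr
    have : b^2 ≤ (r^2)^2 := by
      have r0 : 0 < r^2 := by positivity
      rw [sub_nonpos, div_le_iff₀ r0] at h
      linarith
    exact abs_le_of_sq_le_sq this (by positivity)
  have lim : Filter.Tendsto (fun r : ℝ => r^2) (nhdsWithin 1 (Ioi 1)) (nhds 1) := by
    have : Filter.Tendsto (fun r : ℝ => r^2) (nhds 1) (nhds (1^2)) := (continuous_pow 2).tendsto 1
    rw [one_pow] at this
    exact this.mono_left nhdsWithin_le_nhds
  exact ge_of_tendsto lim (by filter_upwards [self_mem_nhdsWithin] with r hr using step2 r hr)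

lemma recip_asymp (a₁ a₂ e u : ℂ) (u0 : u ≠ 0) (hu : ‖u‖ ≤ 1/8) (h1 : ‖a₁‖ ≤ 2) (h2 : ‖a₂‖ ≤ 4)
    (he : ‖e‖ ≤ 16) :
    ‖(u + a₁ * u^2 + a₂ * u^3 + e * u^4)⁻¹ - (u⁻¹ - a₁ - (a₂ - a₁^2) * u)‖ ≤ 100 * ‖u‖^2 := by
  set V := a₂ - a₁^2 with hV
  have hVn : ‖V‖ ≤ 8 := by
    refine (norm_sub_le _ _).trans ?_
    rw [norm_pow]; nlinarith [norm_nonneg a₁]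
  set s := 1 + (a₁ * u + a₂ * u^2 + e * u^3) with hs
  have hun := norm_nonneg u
  have hδ : ‖a₁ * u + a₂ * u^2 + e * u^3‖ ≤ 1/2 := by
    refine norm_add₃_le.trans ?_
    simp only [norm_mul, norm_pow]
    have : ‖a₁‖ * ‖u‖ ≤ 2 * (1/8) := by gcongr
    have : ‖a₂‖ * ‖u‖^2 ≤ 4 * (1/8)^2 := by gcongr
    have : ‖e‖ * ‖u‖^3 ≤ 16 * (1/8)^3 := by gcongr
    linarith
  have hsn : 1/2 ≤ ‖s‖ := by
    have := norm_sub_le s (a₁ * u + a₂ * u^2 + e * u^3)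
    rw [hs, add_sub_cancel_right, norm_one, ← hs] at this
    linarith
  have s0 : s ≠ 0 := by rw [← norm_pos_iff]; linarith
  have eq : (u + a₁ * u^2 + a₂ * u^3 + e * u^4)⁻¹ - (u⁻¹ - a₁ - V * u) =
      u^2 * (-(e - a₁ * a₂ - a₁ * V) + u * (a₁ * e + a₂ * V) + u^2 * (e * V)) * s⁻¹ := by
    have : u + a₁ * u^2 + a₂ * u^3 + e * u^4 = u * s := by rw [hs]; ring
    rw [this]
    field_simp
    rw [hs, hV]; ring
  rw [eq, norm_mul, norm_mul, norm_inv, norm_pow]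
  have hsi : ‖s‖⁻¹ ≤ 2 := by
    rw [inv_le_comm₀ (by linarith) (by norm_num)]; linarith
  have hp : ‖-(e - a₁ * a₂ - a₁ * V) + u * (a₁ * e + a₂ * V) + u^2 * (e * V)‖ ≤ 50 := by
    refine norm_add₃_le.trans ?_
    have k1 : ‖-(e - a₁ * a₂ - a₁ * V)‖ ≤ 16 + 2 * 4 + 2 * 8 := by
      rw [norm_neg]
      refine (norm_sub_le _ _).trans (add_le_add ((norm_sub_le _ _).trans (add_le_add he ?_)) ?_)
      · rw [norm_mul]; gcongr
      · rw [norm_mul]; gcongr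
    have k2 : ‖u * (a₁ * e + a₂ * V)‖ ≤ 1/8 * (2 * 16 + 4 * 8) := by
      rw [norm_mul]
      gcongr
      refine (norm_add_le _ _).trans (add_le_add ?_ ?_)
      · rw [norm_mul]; gcongr
      · rw [norm_mul]; gcongr
    have k3 : ‖u^2 * (e * V)‖ ≤ (1/8)^2 * (16 * 8) := by
      rw [norm_mul, norm_mul, norm_pow]; gcongr
    linarith
  calc ‖u‖^2 * _ * ‖s‖⁻¹ ≤ ‖u‖^2 * 50 * 2 := by gcongr
    _ = _ := by ring

end

/-- Let `μ` be a probability measure on `ℝ` with support in `[-2,2]` and moments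
`aₙ = ∫ xⁿ dμ`.  If the reciprocal Cauchy transform of `μ` is univalent on the
upper half-plane, then `|1 + a₁² - a₂| ≤ 1`. -/
theorem grunsky_N1_inequality (μ : Measure ℝ) [IsProbabilityMeasure μ]
    (hsupp : μ (Set.Icc (-2 : ℝ) 2)ᶜ = 0)
    (huniv : Set.InjOn (fun z : ℂ => (∫ x : ℝ, (z - (x : ℂ))⁻¹ ∂μ)⁻¹)
      {z : ℂ | 0 < z.im}) :
    |1 + (∫ x : ℝ, x ∂μ) ^ 2 - ∫ x : ℝ, x ^ 2 ∂μ| ≤ 1 := by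
  have n1 : ‖∫ x : ℝ, x ∂μ‖ ≤ 2 := by
    have := norm_integral_le_of_norm_le_const (μ := μ) (f := fun x : ℝ => x) (C := 2) (by
      filter_upwards [supp_ae hsupp] with x hx using abs_le.2 hx)
    simpa using this
  have n2 : ‖∫ x : ℝ, x^2 ∂μ‖ ≤ 4 := by
    have := norm_integral_le_of_norm_le_const (μ := μ) (f := fun x : ℝ => x^2) (C := 4) (by
      filter_upwards [supp_ae hsupp] with x hx
      rw [norm_pow, Real.norm_eq_abs, sq_abs]; nlinarith [hx.1, hx.2])
    simpa using this
  have hasy := fun (z : ℂ) (hz : 4 ≤ ‖z‖) => cG_asymp hsupp hz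
  generalize (∫ x : ℝ, x ∂μ) = a₁ at *
  generalize (∫ x : ℝ, x^2 ∂μ) = a₂ at *
  have hne : ∀ ζ : ℂ, 1 < ‖ζ‖ → ζ ≠ 0 := fun ζ h => by rw [← norm_pos_iff]; linarith
  refine area_thm (g := fun ζ => (cG μ (ζ + ζ⁻¹))⁻¹ + a₁) (C := 408) (K := 16) ?_ ?_ ?_
  · intro ζ hζ
    have hζ' : 1 < ‖ζ‖ := hζ
    apply DifferentiableAt.differentiableWithinAt
    apply DifferentiableAt.add_const
    refine DifferentiableAt.fun_inv (h := fun ζ : ℂ => cG μ (ζ + ζ⁻¹)) ?_ (cG_ne hsupp (psi_mem hζ'))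
    have h1 : DifferentiableAt ℂ (fun ζ : ℂ => ζ + ζ⁻¹) ζ :=
      differentiableAt_id.add (differentiableAt_id.inv (hne ζ hζ'))
    exact DifferentiableAt.comp (g := cG μ) (f := fun ζ : ℂ => ζ + ζ⁻¹) ζ (cG_diff hsupp (psi_mem hζ')) h1
  · intro z hz w hw h
    have h' := inv_injective (add_right_cancel h)
    exact psi_inj hz hw (cG_inj hsupp huniv (psi_mem hz) (psi_mem hw) h')
  · intro ζ hζ
    have ζ0 : ζ ≠ 0 := hne ζ (by linarith)
    set z := ζ + ζ⁻¹ with hz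
    have hp : 0 < ‖ζ‖ := by linarith
    have hi : ‖ζ⁻¹‖ ≤ 1 := by
      rw [norm_inv]; exact inv_le_one_of_one_le₀ (by linarith)
    have hzl : ‖ζ‖ / 2 ≤ ‖z‖ := by
      have := norm_sub_le z ζ⁻¹
      rw [hz, add_sub_cancel_right, ← hz] at this
      linarith
    have z0 : z ≠ 0 := by rw [← norm_pos_iff]; linarith
    obtain ⟨e, he, hG⟩ := hasy z (by linarith)
    have hzi : ‖z⁻¹‖ ≤ 2 / ‖ζ‖ := by
      rw [norm_inv, inv_le_comm₀ (by linarith) (by positivity), inv_div]; exact hzl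
    have hzi8 : ‖z⁻¹‖ ≤ 1/8 := hzi.trans (by rw [div_le_iff₀ hp]; linarith)
    have key := recip_asymp a₁ a₂ e z⁻¹ (inv_ne_zero z0) hzi8 (by rwa [norm_real])
      (by rwa [norm_real]) he
    rw [← hG, inv_inv] at key
    have hV : ‖(a₂ - a₁^2 : ℂ)‖ ≤ 8 := by
      refine (norm_sub_le _ _).trans ?_
      rw [norm_pow, norm_real, norm_real]; nlinarith [norm_nonneg a₁]
    have eq : (cG μ z)⁻¹ + a₁ - ζ - ((1 + a₁^2 - a₂ : ℝ):ℂ) / ζ =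
        ((cG μ z)⁻¹ - (z - a₁ - (a₂ - a₁^2) * z⁻¹)) + (a₂ - a₁^2) * (z⁻¹ * ζ⁻¹^2) := by
      have h3 : z⁻¹ * ζ⁻¹^2 = ζ⁻¹ - z⁻¹ := by
        have : z * ζ = ζ^2 + 1 := by rw [hz]; field_simp
        field_simp
        linear_combination (-1:ℂ) * this
      rw [h3, hz]; push_cast; ring
    show ‖(cG μ z)⁻¹ + a₁ - ζ - ((1 + a₁^2 - a₂ : ℝ):ℂ) / ζ‖ ≤ _
    rw [eq]
    refine (norm_add_le _ _).trans ?_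
    have b1 : 100 * ‖z⁻¹‖^2 ≤ 100 * (2 / ‖ζ‖)^2 := by gcongr
    have b2 : ‖(a₂ - a₁^2 : ℂ) * (z⁻¹ * ζ⁻¹^2)‖ ≤ 8 * (1 * ‖ζ‖⁻¹^2) := by
      rw [norm_mul, norm_mul, norm_pow, norm_inv ζ]
      gcongr
      linarith
    have : 408 / ‖ζ‖^2 = 100 * (2 / ‖ζ‖)^2 + 8 * (1 * ‖ζ‖⁻¹^2) := by field_simp; norm_num
    linarith
end

section
/- If μ is a probability measure on ℝ with finite variance σ², then the restriction of its reciprocal Cauchy transform F to {Im z > σ} takes every value in {Im w > 2σ} exactly once. -/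
open MeasureTheory Complex Set

lemma rc_cs (μ : Measure ℝ) (f g : ℝ → ℂ) (hf : MemLp f 2 μ) (hg : MemLp g 2 μ) :
    ‖∫ x, f x * g x ∂μ‖ ^ 2 ≤ (∫ x, ‖f x‖ ^ 2 ∂μ) * (∫ x, ‖g x‖ ^ 2 ∂μ) := by
  have i1 : Integrable (fun x => ‖f x‖ ^ 2) μ := hf.norm.integrable_sq
  have i2 : Integrable (fun x => ‖g x‖ ^ 2) μ := hg.norm.integrable_sq
  have i3 : Integrable (fun x => ‖f x‖ * ‖g x‖) μ := hf.norm.integrable_mul hg.norm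
  have h1 : ‖∫ x, f x * g x ∂μ‖ ≤ ∫ x, ‖f x‖ * ‖g x‖ ∂μ := by
    refine (norm_integral_le_integral_norm _).trans_eq ?_
    simp
  have h0 : 0 ≤ ‖∫ x, f x * g x ∂μ‖ := norm_nonneg _
  have key : ∀ t : ℝ, 0 ≤ (∫ x, ‖f x‖ ^ 2 ∂μ) * (t * t) + (2 * ∫ x, ‖f x‖ * ‖g x‖ ∂μ) * t
      + (∫ x, ‖g x‖ ^ 2 ∂μ) := by
    intro t
    have : 0 ≤ ∫ x, (‖f x‖ * t + ‖g x‖) ^ 2 ∂μ := integral_nonneg fun x => sq_nonneg _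
    have e : ∀ x, (‖f x‖ * t + ‖g x‖) ^ 2 =
        ‖f x‖ ^ 2 * (t * t) + (‖f x‖ * ‖g x‖) * (2 * t) + ‖g x‖ ^ 2 := fun x => by ring
    simp_rw [e] at this
    rw [integral_add (f := fun x => ‖f x‖ ^ 2 * (t * t) + (‖f x‖ * ‖g x‖) * (2 * t))
      ((i1.mul_const _).add (i3.mul_const _)) i2,
      integral_add (i1.mul_const _) (i3.mul_const _), integral_mul_const, integral_mul_const] at this
    linarith
  have := discrim_le_zero key
  unfold discrim at this
  nlinarith

lemma rc_data (μ : Measure ℝ) [IsProbabilityMeasure μ] (z : ℂ) (hz : 0 < z.im) :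
    (∫ x : ℝ, (z - (x : ℂ))⁻¹ ∂μ) ≠ 0 ∧ ∃ u : ℝ → ℂ, MemLp u 2 μ ∧ ∫ x, u x ∂μ = 0 ∧
      ∀ x : ℝ, (z - x) * (1 + u x) = (∫ x : ℝ, (z - (x : ℂ))⁻¹ ∂μ)⁻¹ := by
  have hne : ∀ x : ℝ, z - (x : ℂ) ≠ 0 := by
    intro x h
    have := congrArg Complex.im h
    simp at this
    linarith
  have hc : Continuous (fun x : ℝ => (z - (x : ℂ))⁻¹) := by
    apply Continuous.inv₀ _ hne
    fun_prop
  have hb : ∀ x : ℝ, ‖(z - (x : ℂ))⁻¹‖ ≤ z.im⁻¹ := by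
    intro x
    rw [norm_inv]
    apply inv_anti₀ hz
    have := Complex.abs_im_le_norm (z - x)
    simp at this
    exact (le_abs_self _).trans this
  have hL : MemLp (fun x : ℝ => (z - (x : ℂ))⁻¹) 2 μ :=
    MemLp.of_bound hc.aestronglyMeasurable _ (Filter.Eventually.of_forall hb)
  have hi : Integrable (fun x : ℝ => (z - (x : ℂ))⁻¹) μ := hL.integrable (by norm_num)
  have hG : (∫ x : ℝ, (z - (x : ℂ))⁻¹ ∂μ) ≠ 0 := by
    intro h
    have h1 : ∫ x : ℝ, -((z - (x : ℂ))⁻¹).im ∂μ = 0 := by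
      rw [integral_neg]
      have := integral_im (𝕜 := ℂ) hi
      simp only [RCLike.im_to_complex] at this
      rw [this, h]; simp
    have hpos : ∀ x : ℝ, 0 < -((z - (x : ℂ))⁻¹).im := by
      intro x
      rw [Complex.inv_im]
      have : 0 < Complex.normSq (z - x) := Complex.normSq_pos.2 (hne x)
      simp
      rw [neg_div]
      exact neg_neg_of_pos (div_pos hz this)
    have h2 : 0 < ∫ x : ℝ, -((z - (x : ℂ))⁻¹).im ∂μ := by
      rw [integral_pos_iff_support_of_nonneg (fun x => (hpos x).le) hi.im.neg]
      have : Function.support (fun x : ℝ => -((z - (x : ℂ))⁻¹).im) = univ := by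
        ext x; simpa using (neg_pos.1 (hpos x)).ne
      rw [this]; simp
    linarith
  refine ⟨hG, fun x => (∫ x : ℝ, (z - (x : ℂ))⁻¹ ∂μ)⁻¹ * (z - (x : ℂ))⁻¹ - 1, ?_, ?_, ?_⟩
  · exact (hL.const_mul _).sub (memLp_const _)
  · rw [integral_sub (hi.const_mul _) (integrable_const _), integral_const_mul,
      inv_mul_cancel₀ hG]
    simp
  · intro x
    have := hne x
    field_simp
    ring

lemma rc_bound (μ : Measure ℝ) [IsProbabilityMeasure μ] (σ m : ℝ) (hσ : 0 ≤ σ)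
    (hf : MemLp (fun x : ℝ => ((x : ℂ) - m)) 2 μ) 
    (hf0 : ∫ x : ℝ, ((x : ℂ) - m) ∂μ = 0)
    (hvar : ∫ x : ℝ, ‖(x : ℂ) - m‖ ^ 2 ∂μ = σ ^ 2) (z F : ℂ) (hz : 0 < z.im)
    (u : ℝ → ℂ) (hu : MemLp u 2 μ) (hu0 : ∫ x, u x ∂μ = 0)
    (huF : ∀ x : ℝ, (z - x) * (1 + u x) = F) :
    (∫ x, ‖u x‖ ^ 2 ∂μ) ≤ (σ / z.im) ^ 2 ∧ ‖z - m - F‖ ≤ σ ^ 2 / z.im := by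
  have iu : Integrable u μ := hu.integrable (by norm_num)
  have jf : Integrable (fun x : ℝ => ((x : ℂ) - m)) μ := hf.integrable (by norm_num)
  have hs : MemLp (fun x => (starRingEnd ℂ) (u x)) 2 μ := hu.star
  have is : Integrable (fun x => (starRingEnd ℂ) (u x)) μ := hs.integrable (by norm_num)
  have ifs : Integrable (fun x : ℝ => ((x : ℂ) - m) * (starRingEnd ℂ) (u x)) μ := hf.integrable_mul hs
  have ns : 0 ≤ ∫ x, ‖u x‖ ^ 2 ∂μ := integral_nonneg fun x => sq_nonneg _
  have e1 : z.im * (∫ x, ‖u x‖ ^ 2 ∂μ) = (∫ x : ℝ, ((x : ℂ) - m) * (starRingEnd ℂ) (u x) ∂μ).im := by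
    have p : ∀ x : ℝ, z.im * ‖u x‖ ^ 2 =
        ((F - z + m) * (starRingEnd ℂ) (u x) + ((x : ℂ) - m) * (starRingEnd ℂ) (u x)).im := by
      intro x
      have : (F - z + m) * (starRingEnd ℂ) (u x) + ((x : ℂ) - m) * (starRingEnd ℂ) (u x)
          = (z - x) * (u x * (starRingEnd ℂ) (u x)) := by
        rw [← huF x]; ring
      rw [this, Complex.mul_conj, Complex.normSq_eq_norm_sq]
      rw [Complex.im_mul_ofReal]; simp
    rw [← integral_const_mul]
    simp_rw [p]
    have it := integral_im (𝕜 := ℂ) ((is.const_mul (F - z + m)).add ifs)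
    simp only [RCLike.im_to_complex, Pi.add_apply] at it
    rw [it, integral_add (is.const_mul _) ifs, integral_const_mul, integral_conj, hu0]
    simp
  have c1 := rc_cs μ _ _ hf hs
  simp only [RCLike.norm_conj] at c1
  rw [hvar] at c1
  have c2 := Complex.abs_im_le_norm (∫ x : ℝ, ((x : ℂ) - m) * (starRingEnd ℂ) (u x) ∂μ)
  rw [← e1, abs_of_nonneg (by positivity)] at c2
  have c3 := rc_cs μ _ _ hf hu
  rw [hvar] at c3
  have e2 : ∫ x : ℝ, ((x : ℂ) - m) * u x ∂μ = z - m - F := by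
    have p : ∀ x : ℝ, ((x : ℂ) - m) * u x = (z - m) * u x + (z - m - F) - ((x : ℂ) - m) := by
      intro x; rw [← huF x]; ring
    simp_rw [p]
    rw [integral_sub (f := fun x => (z - m) * u x + (z - m - F))
      ((iu.const_mul _).add (integrable_const _)) jf,
      integral_add (iu.const_mul _) (integrable_const _), integral_const_mul, hu0, hf0]
    simp
  rw [e2] at c3
  set A := ∫ x, ‖u x‖ ^ 2 ∂μ
  have b : A ≤ (σ / z.im) ^ 2 := by
    rw [div_pow, le_div_iff₀ (by positivity)]
    have : (z.im * A) ^ 2 ≤ σ ^ 2 * A := (pow_le_pow_left₀ (by positivity) c2 2).trans c1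
    rcases ns.eq_or_lt with h | h
    · rw [← h]; nlinarith
    · refine le_of_mul_le_mul_right ?_ h
      nlinarith
  refine ⟨b, ?_⟩
  refine (pow_le_pow_iff_left₀ (norm_nonneg _) (by positivity) two_ne_zero).1 ?_
  calc _ ≤ σ ^ 2 * A := c3
    _ ≤ σ ^ 2 * (σ / z.im) ^ 2 := by gcongr
    _ = _ := by ring

lemma rc_diff (μ : Measure ℝ) [IsProbabilityMeasure μ] (z F z' F' : ℂ)
    (u : ℝ → ℂ) (hu : MemLp u 2 μ) (hu0 : ∫ x, u x ∂μ = 0)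
    (huF : ∀ x : ℝ, (z - x) * (1 + u x) = F)
    (v : ℝ → ℂ) (hv : MemLp v 2 μ) (hv0 : ∫ x, v x ∂μ = 0)
    (hvF : ∀ x : ℝ, (z' - x) * (1 + v x) = F') :
    F - F' = (z - z') * (1 + ∫ x, u x * v x ∂μ) := by
  have iu : Integrable u μ := hu.integrable (by norm_num)
  have iv : Integrable v μ := hv.integrable (by norm_num)
  have iuv : Integrable (fun x => u x * v x) μ := hu.integrable_mul hv
  have p : ∀ x : ℝ, (z - z') * (u x * v x) =
      ((F - (z - z')) * v x - (F' + (z - z')) * u x) + (F - F' - (z - z')) := by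
    intro x
    have h1 := huF x
    have h2 := hvF x
    linear_combination (-(1 + v x)) * (-h1) * (1) + (1 + u x) * (-h2)
  have q : ∫ x, (z - z') * (u x * v x) ∂μ = F - F' - (z - z') := by
    simp_rw [p]
    rw [integral_add (f := fun x => (F - (z - z')) * v x - (F' + (z - z')) * u x)
      ((iv.const_mul _).sub (iu.const_mul _)) (integrable_const _),
      integral_sub (iv.const_mul _) (iu.const_mul _), integral_const_mul, integral_const_mul,
      hu0, hv0]
    simp
  rw [integral_const_mul] at q
  linear_combination -q

/-- If `μ` is a probability measure on `ℝ` with finite variance `σ²`, then the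
restriction of its reciprocal Cauchy transform `F` to `{Im z > σ}` takes every
value in `{Im w > 2σ}` exactly once. -/
theorem reciprocal_cauchy_transform_bijective_on_halfplane
    (μ : Measure ℝ) [IsProbabilityMeasure μ] (σ m : ℝ) (hσ : 0 ≤ σ)
    (hm : ∫ x : ℝ, x ∂μ = m)
    (hint : Integrable (fun x : ℝ => (x - m) ^ 2) μ)
    (hvar : ∫ x : ℝ, (x - m) ^ 2 ∂μ = σ ^ 2) :
    ∀ w : ℂ, 2 * σ < w.im →
      ∃! z : ℂ, σ < z.im ∧ (∫ x : ℝ, (z - (x : ℂ))⁻¹ ∂μ)⁻¹ = w := by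
  have hfr : MemLp (fun x : ℝ => x - m) 2 μ :=
    (memLp_two_iff_integrable_sq (by fun_prop)).2 hint
  have hf : MemLp (fun x : ℝ => ((x : ℂ) - m)) 2 μ := by
    have := hfr.ofReal (K := ℂ)
    simpa using this
  have ifr : Integrable (fun x : ℝ => x - m) μ := hfr.integrable (by norm_num)
  have ix : Integrable (fun x : ℝ => x) μ := by
    have h := ifr.add (integrable_const m)
    have e : ((fun x : ℝ => x - m) + fun _ => m) = fun x => x := by ext x; simp
    rwa [e] at h
  have hf0 : ∫ x : ℝ, ((x : ℂ) - m) ∂μ = 0 := by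
    have : ∫ x : ℝ, (x - m) ∂μ = 0 := by
      rw [integral_sub ix (integrable_const _), hm]; simp
    have h2 := integral_ofReal (𝕜 := ℂ) (μ := μ) (f := fun x : ℝ => x - m)
    rw [this] at h2
    simpa using h2
  have hv : ∫ x : ℝ, ‖(x : ℂ) - m‖ ^ 2 ∂μ = σ ^ 2 := by
    rw [← hvar]
    congr 1; ext x
    rw [← Complex.ofReal_sub, Complex.norm_real, Real.norm_eq_abs, sq_abs]
  set F : ℂ → ℂ := fun z => (∫ x : ℝ, (z - (x : ℂ))⁻¹ ∂μ)⁻¹ with hF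
  have H1 : ∀ z : ℂ, 0 < z.im → ‖z - m - F z‖ ≤ σ ^ 2 / z.im := by
    intro z hz
    obtain ⟨-, u, hu, hu0, huF⟩ := rc_data μ z hz
    exact (rc_bound μ σ m hσ hf hf0 hv z _ hz u hu hu0 huF).2
  have H2 : ∀ z z' : ℂ, ∀ c : ℝ, 0 < c → c ≤ z.im → c ≤ z'.im →
      ‖(z - m - F z) - (z' - m - F z')‖ ≤ (σ / c) ^ 2 * ‖z - z'‖ := by
    intro z z' c hc hz hz'
    obtain ⟨-, u, hu, hu0, huF⟩ := rc_data μ z (by linarith)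
    obtain ⟨-, v, hv', hv0, hvF⟩ := rc_data μ z' (by linarith)
    have b1 := (rc_bound μ σ m hσ hf hf0 hv z _ (by linarith) u hu hu0 huF).1
    have b2 := (rc_bound μ σ m hσ hf hf0 hv z' _ (by linarith) v hv' hv0 hvF).1
    have d : F z - F z' = _ := rc_diff μ z _ z' _ u hu hu0 huF v hv' hv0 hvF
    have e : (z - m - F z) - (z' - m - F z') = -((∫ x, u x * v x ∂μ) * (z - z')) := by
      linear_combination -d
    rw [e, norm_neg, norm_mul]
    gcongr
    have c1 := rc_cs μ u v hu hv'
    refine (pow_le_pow_iff_left₀ (norm_nonneg _) (by positivity) two_ne_zero).1 ?_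
    have k1 : (σ / z.im) ^ 2 ≤ (σ / c) ^ 2 := by gcongr; exact div_nonneg hσ (by linarith)
    have k2 : (σ / z'.im) ^ 2 ≤ (σ / c) ^ 2 := by gcongr; exact div_nonneg hσ (by linarith)
    calc _ ≤ _ := c1
      _ ≤ (σ / c) ^ 2 * (σ / c) ^ 2 := by
        apply mul_le_mul (b1.trans k1) (b2.trans k2) (integral_nonneg fun x => sq_nonneg _)
          (by positivity)
      _ = _ := by ring
  have K1 : ∀ c : ℝ, σ < c → (σ / c) ^ 2 < 1 := by
    intro c hc
    have : σ / c < 1 := by rw [div_lt_one (by linarith)]; exact hc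
    have : 0 ≤ σ / c := div_nonneg hσ (by linarith)
    nlinarith
  intro w hw
  obtain ⟨c, hc, hcw⟩ : ∃ c, σ < c ∧ c = w.im - σ := ⟨w.im - σ, by linarith, rfl⟩
  have c0 : 0 < c := by linarith
  let T : ℂ → ℂ := fun z => w + m + (z - m - F z)
  let S : Set ℂ := {z | c ≤ z.im}
  have hS : IsClosed S := isClosed_le continuous_const Complex.continuous_im
  have hST : MapsTo T S S := by
    intro z hz
    have hz : c ≤ z.im := hz
    have h1 := H1 z (by linarith)
    have h2 := (Complex.abs_im_le_norm _).trans h1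
    have h3 : σ ^ 2 / z.im ≤ σ := by
      rw [div_le_iff₀ (by linarith)]; nlinarith
    have h4 := (abs_le.1 (h2.trans h3)).1
    change c ≤ (w + m + (z - m - F z)).im
    rw [Complex.add_im, Complex.add_im, Complex.ofReal_im]
    linarith
  have hT : ContractingWith ⟨(σ / c) ^ 2, by positivity⟩ (hST.restrict T S S) := by
    refine ⟨K1 c hc, LipschitzWith.of_dist_le_mul ?_⟩
    rintro ⟨z, hz⟩ ⟨z', hz'⟩
    have := H2 z z' c c0 hz hz'
    rw [Subtype.dist_eq, Subtype.dist_eq, dist_eq_norm, dist_eq_norm]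
    have e : T z - T z' = (z - m - F z) - (z' - m - F z') := by simp only [T]; ring
    change ‖T z - T z'‖ ≤ (σ / c) ^ 2 * ‖z - z'‖
    rw [e]; exact this
  obtain ⟨z, hzS, hfix, -⟩ := hT.exists_fixedPoint' hS.isComplete hST (x := (c : ℂ) * I)
    (by simp [S]) (edist_ne_top _ _)
  have hzS : c ≤ z.im := hzS
  have hfix : w + m + (z - m - F z) = z := hfix
  refine ⟨z, ⟨by linarith, ?_⟩, ?_⟩
  · change F z = w
    linear_combination -hfix
  · rintro y ⟨hy, hyw⟩
    have hyw : F y = w := hyw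
    have hzw : F z = w := by linear_combination -hfix
    by_contra hne
    have hd : σ < min c y.im := lt_min hc hy
    have h := H2 y z (min c y.im) (by linarith) (min_le_right _ _) ((min_le_left _ _).trans hzS)
    rw [hyw, hzw, show y - m - w - (z - m - w) = y - z by ring] at h
    have := norm_pos_iff.2 (sub_ne_zero.2 hne)
    nlinarith [K1 _ hd]
end

section
/- Let μ be an even probability measure (all odd moments vanish) with support in [-2,2] and moments a_n = ∫ x^n dμ. If the reciprocal Cauchy transform of μ is univalent on the upper half-plane, then a₂ ≤ 2 and |1 + 3a₂² − 2a₄| ≤ 1. -/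
open MeasureTheory Complex Set

lemma det_mul (w : ℂ) : ((ContinuousLinearMap.toSpanSingleton ℂ w).restrictScalars ℝ).det = ‖w‖^2 := by
  simp [ContinuousLinearMap.det, LinearMap.det_restrictScalars, Complex.sq_norm, Algebra.norm_complex_apply]

lemma ellipse_vol (A B : ℝ) (hA : 0 < A) (hB : 0 < B) (c : ℂ) :
    volume {w : ℂ | ((w - c).re / A)^2 + ((w - c).im / B)^2 ≤ 1} = ENNReal.ofReal (Real.pi * (A * B)) := by
  let L : ℂ →ₗ[ℝ] ℂ := Matrix.toLin basisOneI basisOneI !![A⁻¹, 0; 0, B⁻¹]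
  have hdet : LinearMap.det L = A⁻¹ * B⁻¹ := by
    simp [L, LinearMap.det_toLin]
  have hL : ∀ w : ℂ, L w = ⟨w.re / A, w.im / B⟩ := by
    intro w
    simp only [L, Matrix.toLin_apply]
    apply Complex.ext <;>
    simp [Matrix.mulVec, dotProduct, Fin.sum_univ_two] <;> ring
  have hne : LinearMap.det L ≠ 0 := by rw [hdet]; positivity
  have : {w : ℂ | ((w - c).re / A)^2 + ((w - c).im / B)^2 ≤ 1} =
      (fun w => w + (-c)) ⁻¹' (L ⁻¹' (Metric.closedBall 0 1)) := by
    ext w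
    simp only [mem_preimage, hL, mem_closedBall_zero_iff, mem_ofPred_eq]
    rw [← sq_le_one_iff₀ (norm_nonneg _), Complex.sq_norm, normSq_apply]
    simp [sub_eq_add_neg, sq]
  rw [this, measure_preimage_add_right, Measure.addHaar_preimage_linearMap _ hne, hdet,
    Complex.volume_closedBall]
  rw [abs_of_pos (by positivity)]
  have : (A⁻¹ * B⁻¹)⁻¹ = A * B := by field_simp
  rw [this]
  simp
  rw [mul_comm Real.pi, ENNReal.ofReal_mul (mul_pos hA hB).le, ENNReal.ofReal_mul hA.le,
    ← NNReal.coe_real_pi, ENNReal.ofReal_coe_nnreal]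

lemma circle_lower {P : ℂ → ℂ} (hP : DifferentiableOn ℂ P (Metric.ball 0 1)) {b : ℝ}
    (hb : deriv P 0 = b) {r : ℝ} (hr0 : 0 < r) (hr1 : r < 1) :
    2 * Real.pi * ((r ^ 4)⁻¹ + b ^ 2) ≤
      ∫ θ in (-Real.pi)..Real.pi, ‖-((circleMap 0 r θ) ^ 2)⁻¹ + deriv P (circleMap 0 r θ)‖ ^ 2 := by
  have hP' : DifferentiableOn ℂ (deriv P) (Metric.ball 0 1) := hP.deriv Metric.isOpen_ball
  set Q : ℂ → ℂ := fun u => -2 * b * u ^ 2 / r ^ 4 + 2 * (-u ^ 2 / r ^ 4 + b) * (deriv P u - b) with hQ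
  have hsub : Metric.closedBall (0:ℂ) r ⊆ Metric.ball 0 1 := Metric.closedBall_subset_ball hr1
  have hQd : DifferentiableOn ℂ Q (Metric.ball 0 1) := by
    rw [hQ]; fun_prop
  have hQav : Real.circleAverage Q 0 r = 0 := by
    rw [DiffContOnCl.circleAverage]
    · simp [hQ, hb]
    · rw [abs_of_pos hr0]
      refine DifferentiableOn.diffContOnCl ?_
      rw [closure_ball _ hr0.ne']
      exact hQd.mono hsub
  have hmem : ∀ θ, circleMap 0 r θ ∈ Metric.ball (0:ℂ) 1 := fun θ =>
    hsub (circleMap_mem_closedBall 0 hr0.le θ)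
  have hcm : Continuous (circleMap 0 r) := continuous_circleMap 0 r
  have hQc : Continuous fun θ => Q (circleMap 0 r θ) :=
    hQd.continuousOn.comp_continuous hcm hmem
  have hPc : Continuous fun θ => deriv P (circleMap 0 r θ) :=
    hP'.continuousOn.comp_continuous hcm hmem
  have hne : ∀ θ, circleMap 0 r θ ≠ 0 := fun θ => circleMap_ne_center hr0.ne'
  have hQint : ∫ θ in (-Real.pi)..Real.pi, Q (circleMap 0 r θ) = 0 := by
    rw [Real.circleAverage_eq_integral_add (-Real.pi)] at hQav
    have h2 : ((2 * Real.pi)⁻¹ : ℝ) ≠ 0 := by positivity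
    have := (smul_eq_zero.mp hQav).resolve_left h2
    rw [intervalIntegral.integral_comp_add_right (fun θ => Q (circleMap 0 r θ))] at this
    convert this using 2 <;> ring
  have hQre : ∫ θ in (-Real.pi)..Real.pi, (Q (circleMap 0 r θ)).re = 0 := by
    have := Complex.reCLM.intervalIntegral_comp_comm (hQc.intervalIntegrable (-Real.pi) Real.pi) (μ := volume)
    simp only [Complex.reCLM_apply] at this
    rw [this, hQint]; simp
  have hle : ∀ u : ℂ, ‖u‖ = r → (r ^ 4)⁻¹ + b ^ 2 + (Q u).re ≤ ‖-(u ^ 2)⁻¹ + deriv P u‖ ^ 2 := by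
    intro u hu
    have hinv : (u ^ 2)⁻¹ = (starRingEnd ℂ) (u ^ 2) / r ^ 4 := by
      rw [Complex.inv_def, normSq_eq_norm_sq, norm_pow, hu]
      push_cast; ring_nf
    have hn : (u^2).re ^2 + (u^2).im ^2 = r ^ 4 := by
      have : ‖u^2‖^2 = r^4 := by rw [norm_pow, hu]; ring
      rw [← this, Complex.sq_norm, normSq_apply]; ring
    rw [Complex.sq_norm, hinv, normSq_apply, hQ]
    beta_reduce
    generalize u^2 = v at *
    generalize deriv P u = d
    have e4 : ((r:ℂ)^4) = ((r^4 : ℝ) : ℂ) := by push_cast; ring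
    have h4 : 0 < r^4 := by positivity
    simp only [e4, ← hn]
    rw [← hn] at h4
    obtain ⟨x, y⟩ := v
    obtain ⟨p, q⟩ := d
    simp only at h4
    simp only [Complex.add_re, Complex.mul_re, Complex.neg_re, Complex.sub_re, Complex.div_ofReal_re,
      Complex.div_ofReal_im, Complex.add_im, Complex.mul_im, Complex.neg_im, Complex.sub_im,
      Complex.conj_re, Complex.conj_im, Complex.ofReal_re, Complex.ofReal_im, Complex.re_ofNat, Complex.im_ofNat]
    rw [← sub_nonneg]
    have : 0 ≤ (p - b)^2 + q^2 := by positivity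
    convert this using 1
    field_simp
    ring
  have hmono : ∫ θ in (-Real.pi)..Real.pi, ((r ^ 4)⁻¹ + b ^ 2 + (Q (circleMap 0 r θ)).re) ≤
      ∫ θ in (-Real.pi)..Real.pi, ‖-((circleMap 0 r θ) ^ 2)⁻¹ + deriv P (circleMap 0 r θ)‖ ^ 2 := by
    apply intervalIntegral.integral_mono_on
    · linarith [Real.pi_pos]
    · exact (continuous_const.add (Complex.continuous_re.comp hQc)).intervalIntegrable _ _
    · apply Continuous.intervalIntegrable
      have : Continuous fun θ => ((circleMap 0 r θ) ^ 2)⁻¹ :=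
        (hcm.pow 2).inv₀ (fun θ => pow_ne_zero 2 (hne θ))
      fun_prop
    · intro θ _
      apply hle
      simp [abs_of_pos hr0]
  have hQrc : Continuous fun θ => (Q (circleMap 0 r θ)).re := Complex.continuous_re.comp hQc
  rw [intervalIntegral.integral_add (by simp) (hQrc.intervalIntegrable _ _), hQre] at hmono
  simp at hmono
  linarith

lemma area_lower_s19 {P : ℂ → ℂ} (hP : DifferentiableOn ℂ P (Metric.ball 0 1)) {b : ℝ}
    (hb : deriv P 0 = b) (hinj : InjOn (fun u => u⁻¹ + P u) (Metric.ball 0 1 \ {0}))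
    {s ρ : ℝ} (hs : 0 < s) (hsρ : s < ρ) (hρ : ρ < 1) :
    ENNReal.ofReal (Real.pi * ((s ^ 2)⁻¹ - (ρ ^ 2)⁻¹ + b ^ 2 * (ρ ^ 2 - s ^ 2))) ≤
      volume ((fun u => u⁻¹ + P u) '' {u : ℂ | s < ‖u‖ ∧ ‖u‖ < ρ}) := by
  set Ω : Set ℂ := {u : ℂ | s < ‖u‖ ∧ ‖u‖ < ρ} with hΩ
  have hΩm : MeasurableSet Ω := by
    apply IsOpen.measurableSet
    exact (isOpen_lt continuous_const continuous_norm).inter (isOpen_lt continuous_norm continuous_const)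
  have hΩs : Ω ⊆ Metric.ball 0 1 \ {0} := by
    intro u hu
    refine ⟨by simpa using hu.2.trans hρ, ?_⟩
    intro h
    simp only [mem_singleton_iff] at h
    subst h
    have := hu.1
    simp at this
    linarith
  set D : ℂ → ℂ := fun u => -(u ^ 2)⁻¹ + deriv P u with hD
  have hDm : Measurable D := by
    have := measurable_deriv P
    rw [hD]; fun_prop
  have hfd : ∀ u ∈ Ω, HasFDerivWithinAt (fun u => u⁻¹ + P u)
      ((ContinuousLinearMap.toSpanSingleton ℂ (D u)).restrictScalars ℝ) Ω u := by
    intro u hu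
    obtain ⟨hu1, hu0⟩ := hΩs hu
    have h1 : HasDerivAt (fun u => u⁻¹ + P u) (D u) u :=
      (hasDerivAt_inv hu0).add ((hP.differentiableAt (Metric.isOpen_ball.mem_nhds hu1)).hasDerivAt)
    exact (h1.hasFDerivAt.restrictScalars ℝ).hasFDerivWithinAt
  rw [← lintegral_abs_det_fderiv_eq_addHaar_image volume hΩm hfd (hinj.mono hΩs)]
  simp only [det_mul]
  rw [← lintegral_indicator hΩm, ← Complex.lintegral_comp_polarCoord_symm]
  set g : ℝ × ℝ → ENNReal := fun p => ENNReal.ofReal p.1 * ENNReal.ofReal (‖D (circleMap 0 p.1 p.2)‖ ^ 2) with hg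
  have hgm : Measurable g := by
    have : Measurable fun p : ℝ × ℝ => circleMap 0 p.1 p.2 := by
      unfold circleMap; fun_prop
    have := hDm.comp this
    simp only [Function.comp_def] at this
    fun_prop
  have hstep : ∫⁻ p in Ioo s ρ ×ˢ Ioo (-Real.pi) Real.pi, g p ≤
      ∫⁻ p in polarCoord.target, ENNReal.ofReal p.1 • (Ω.indicator (fun a => ENNReal.ofReal |‖D a‖ ^ 2|)
        (Complex.polarCoord.symm p)) := by
    calc _ = ∫⁻ p in Ioo s ρ ×ˢ Ioo (-Real.pi) Real.pi, ENNReal.ofReal p.1 • (Ω.indicator (fun a => ENNReal.ofReal |‖D a‖ ^ 2|)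
        (Complex.polarCoord.symm p)) := by
          apply setLIntegral_congr_fun (measurableSet_Ioo.prod measurableSet_Ioo)
          rintro ⟨r, θ⟩ ⟨hr, hθ⟩
          simp only at hr hθ
          have hr0 : 0 < r := hs.trans hr.1
          have e : Complex.polarCoord.symm (r, θ) = circleMap 0 r θ := by
            simp [circleMap, Complex.exp_mul_I]
          simp only [hg]
          rw [e, indicator_of_mem, smul_eq_mul, abs_of_nonneg (by positivity)]
          simpa [hΩ, abs_of_pos hr0] using hr
      _ ≤ _ := by
          apply lintegral_mono_set
          apply prod_mono
          · intro r hr; exact hs.trans hr.1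
          · exact le_rfl
  refine le_trans ?_ hstep
  rw [Measure.volume_eq_prod, setLIntegral_prod _ hgm.aemeasurable]
  have hinner : ∀ r ∈ Ioo s ρ, ENNReal.ofReal (r * (2 * Real.pi * ((r ^ 4)⁻¹ + b ^ 2))) ≤
      ∫⁻ θ in Ioo (-Real.pi) Real.pi, g (r, θ) := by
    intro r hr
    have hr0 : 0 < r := hs.trans hr.1
    have hr1 : r < 1 := hr.2.trans hρ
    simp only [hg]
    rw [lintegral_const_mul', ENNReal.ofReal_mul hr0.le]
    · gcongr
      rw [← ofReal_integral_eq_lintegral_ofReal]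
      · apply ENNReal.ofReal_le_ofReal
        refine (circle_lower hP hb hr0 hr1).trans ?_
        rw [intervalIntegral.integral_of_le (by linarith [Real.pi_pos]), integral_Ioc_eq_integral_Ioo]
      · apply IntegrableOn.mono_set (t := Icc (-Real.pi) Real.pi) _ Ioo_subset_Icc_self
        apply Continuous.integrableOn_Icc
        have hP' : DifferentiableOn ℂ (deriv P) (Metric.ball 0 1) := hP.deriv Metric.isOpen_ball
        have hcm : Continuous (circleMap 0 r) := continuous_circleMap 0 r
        have hmem : ∀ θ, circleMap 0 r θ ∈ Metric.ball (0:ℂ) 1 := fun θ =>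
          Metric.closedBall_subset_ball hr1 (circleMap_mem_closedBall 0 hr0.le θ)
        have hPc : Continuous fun θ => deriv P (circleMap 0 r θ) :=
          hP'.continuousOn.comp_continuous hcm hmem
        have hne : ∀ θ, circleMap 0 r θ ≠ 0 := fun θ => circleMap_ne_center hr0.ne'
        have : Continuous fun θ => ((circleMap 0 r θ) ^ 2)⁻¹ :=
          (hcm.pow 2).inv₀ (fun θ => pow_ne_zero 2 (hne θ))
        rw [hD]
        fun_prop
      · exact Filter.Eventually.of_forall (fun θ => by positivity)
    · exact ENNReal.ofReal_ne_top
  refine le_trans ?_ (setLIntegral_mono' measurableSet_Ioo hinner)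
  have hcont : ContinuousOn (fun r : ℝ => r * (2 * Real.pi * ((r ^ 4)⁻¹ + b ^ 2))) (Icc s ρ) := by
    have : ∀ r ∈ Icc s ρ, r ^ 4 ≠ 0 := fun r hr => pow_ne_zero 4 (hs.trans_le hr.1).ne'
    fun_prop (disch := assumption)
  rw [← ofReal_integral_eq_lintegral_ofReal]
  · apply ENNReal.ofReal_le_ofReal
    rw [← integral_Ioc_eq_integral_Ioo, ← intervalIntegral.integral_of_le hsρ.le]
    rw [intervalIntegral.integral_eq_sub_of_hasDerivAt (f := fun r => Real.pi * (-(r^2)⁻¹ + b^2 * r^2))]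
    · apply le_of_eq; ring
    · intro r hr
      rw [uIcc_of_le hsρ.le] at hr
      have hr0 : r ≠ 0 := (hs.trans_le hr.1).ne'
      have h0 : HasDerivAt (fun r : ℝ => r ^ 2) (2 * r) r := by simpa using hasDerivAt_pow 2 r
      have h1 : HasDerivAt (fun r : ℝ => Real.pi * (-(r^2)⁻¹ + b^2 * r^2))
          (Real.pi * (-(-(2 * r) / (r ^ 2) ^ 2) + b ^ 2 * (2 * r))) r :=
        (((h0.fun_inv (pow_ne_zero 2 hr0)).fun_neg).fun_add (h0.const_mul (b^2))).const_mul Real.pi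
      refine h1.congr_deriv ?_
      field_simp
      try ring
    · rw [intervalIntegrable_iff_integrableOn_Icc_of_le hsρ.le]
      exact hcont.integrableOn_Icc
  · exact hcont.integrableOn_Icc.mono_set Ioo_subset_Icc_self
  · filter_upwards [ae_restrict_mem measurableSet_Ioo] with r hr
    have hr0 : 0 < r := hs.trans hr.1
    have := Real.pi_pos
    simp only [Pi.zero_apply]
    positivity

lemma lip_half {P : ℂ → ℂ} (hP : DifferentiableOn ℂ P (Metric.ball 0 1)) :
    ∃ M : ℝ, 0 < M ∧ ∀ u v : ℂ, ‖u‖ ≤ 1/2 → ‖v‖ ≤ 1/2 → ‖P u - P v‖ ≤ M * ‖u - v‖ := by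
  have hP' : DifferentiableOn ℂ (deriv P) (Metric.ball 0 1) := hP.deriv Metric.isOpen_ball
  have hsub : Metric.closedBall (0:ℂ) (1/2) ⊆ Metric.ball 0 1 :=
    Metric.closedBall_subset_ball (by norm_num)
  obtain ⟨C, hC⟩ := (isCompact_closedBall (0:ℂ) (1/2)).exists_bound_of_continuousOn
    (hP'.continuousOn.mono hsub)
  refine ⟨max C 1, by positivity, fun u v hu hv => ?_⟩
  refine Convex.norm_image_sub_le_of_norm_deriv_le (s := Metric.closedBall (0:ℂ) (1/2)) (f := P)
    (fun x hx => hP.differentiableAt (Metric.isOpen_ball.mem_nhds (hsub hx)))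
    (fun x hx => (hC x hx).trans (le_max_left _ _)) (convex_closedBall _ _) (by simpa using hv) (by simpa using hu)

lemma solve_near {P : ℂ → ℂ} (hP : DifferentiableOn ℂ P (Metric.ball 0 1)) {b : ℝ}
    (hb : deriv P 0 = b) : ∃ K σ0 : ℝ, 0 < K ∧ 0 < σ0 ∧ ∀ u1 : ℂ, u1 ≠ 0 → ‖u1‖ < σ0 →
      ∃ u : ℂ, u ≠ 0 ∧ ‖u‖ < 1 ∧ ‖u‖ ≤ ‖u1‖ + K * ‖u1‖ ^ 4 ∧ u⁻¹ + P u = u1⁻¹ + P 0 + b * u1 := by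
  obtain ⟨M, hM, hML⟩ := lip_half hP
  have hd : DifferentiableOn ℂ (dslope P 0) (Metric.ball 0 1) :=
    (differentiableOn_dslope (Metric.ball_mem_nhds 0 one_pos)).mpr hP
  obtain ⟨C, hC, hCL⟩ := lip_half hd
  have hR : ∀ u : ℂ, ‖u‖ ≤ 1/2 → ‖P u - P 0 - b * u‖ ≤ C * ‖u‖ ^ 2 := by
    intro u hu
    have h1 : P u - P 0 - b * u = u * (dslope P 0 u - dslope P 0 0) := by
      have := sub_smul_dslope P 0 u
      rw [dslope_same, hb, mul_sub, ← this]
      simp; ring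
    rw [h1, norm_mul]
    have := hCL u 0 hu (by simp)
    rw [sub_zero] at this
    nlinarith [norm_nonneg u]
  set K : ℝ := 8 * (C + 1) with hK
  have hKpos : 0 < K := by positivity
  refine ⟨K, min (1/8) (min (1/(2*K)) (1/(4*M))), hKpos, by positivity, ?_⟩
  intro u1 hu1 hlt
  rw [lt_min_iff, lt_min_iff] at hlt
  obtain ⟨h8, h2K, h4M⟩ := hlt
  set τ := ‖u1‖ with hτ
  have hτ0 : 0 < τ := norm_pos_iff.mpr hu1
  have h2K' : K * τ ≤ 1/2 := by
    rw [lt_div_iff₀ (by positivity)] at h2K; linarith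
  have h4M' : M * τ ≤ 1/4 := by
    rw [lt_div_iff₀ (by positivity)] at h4M; linarith
  set δ := K * τ ^ 4 with hδ
  have hδ0 : 0 < δ := by positivity
  have hδτ : δ ≤ τ / 2 := by
    have : δ = (K * τ) * τ ^ 3 := by rw [hδ]; ring
    have h3 : τ ^ 3 ≤ τ := by nlinarith [pow_pos hτ0 2, pow_pos hτ0 3]
    rw [this]; nlinarith [pow_pos hτ0 3]
  have hball : ∀ u ∈ Metric.closedBall u1 δ, τ / 2 ≤ ‖u‖ ∧ ‖u‖ ≤ 2 * τ := by
    intro u hu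
    rw [mem_closedBall_iff_norm] at hu
    have h1 := norm_sub_norm_le u u1
    have h2 := norm_sub_norm_le u1 u
    rw [norm_sub_rev] at h2
    constructor <;> linarith
  have hest : ∀ u ∈ Metric.closedBall u1 δ,
      ‖u - u1‖ / (4 * τ ^ 2) ≤ ‖(u⁻¹ + P u) - (u1⁻¹ + P u1)‖ := by
    intro u hu
    obtain ⟨h1, h2⟩ := hball u hu
    have hu0 : u ≠ 0 := norm_pos_iff.mp (by linarith)
    have e : (u⁻¹ + P u) - (u1⁻¹ + P u1) = (P u - P u1) - (u - u1) / (u * u1) := by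
      field_simp; ring
    have hl := hML u u1 (by linarith) (by linarith)
    have h3 : ‖u - u1‖ / (2 * τ ^ 2) ≤ ‖(u - u1) / (u * u1)‖ := by
      rw [norm_div, norm_mul]
      apply div_le_div_of_nonneg_left (norm_nonneg _) (by positivity)
      rw [← hτ]; nlinarith
    have h4 : M * ‖u - u1‖ ≤ ‖u - u1‖ / (4 * τ ^ 2) := by
      rw [le_div_iff₀ (by positivity)]
      have : M * ‖u - u1‖ * (4 * τ^2) = ‖u - u1‖ * (4 * (M * τ) * τ) := by ring
      rw [this]
      apply mul_le_of_le_one_right (norm_nonneg _)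
      nlinarith
    have h5 : ‖u - u1‖ / (2 * τ ^ 2) = 2 * (‖u - u1‖ / (4 * τ ^ 2)) := by field_simp; norm_num
    have h6 := norm_sub_norm_le ((u - u1) / (u * u1)) (P u - P u1)
    rw [e, norm_sub_rev (P u - P u1)]
    linarith
  have hdiff : DifferentiableOn ℂ (fun u => u⁻¹ + P u) (Metric.closedBall u1 δ) := by
    intro u hu
    obtain ⟨h1, h2⟩ := hball u hu
    have hu0 : u ≠ 0 := norm_pos_iff.mp (by linarith)
    have h3 : DifferentiableAt ℂ P u := hP.differentiableAt
      (Metric.isOpen_ball.mem_nhds (by rw [mem_ball_zero_iff]; linarith))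
    exact ((differentiableAt_inv hu0).add h3).differentiableWithinAt
  have hsub := DiffContOnCl.ball_subset_image_closedBall (f := fun u => u⁻¹ + P u) (z₀ := u1) (r := δ)
    (ε := δ / (4 * τ ^ 2))
    (DifferentiableOn.diffContOnCl (by rwa [closure_ball _ hδ0.ne'])) hδ0
    (by
      intro z hz
      have := hest z (Metric.sphere_subset_closedBall hz)
      rwa [mem_sphere_iff_norm.mp hz] at this)
    (by
      have h1 : ∀ᶠ z in nhdsWithin u1 {u1}ᶜ, z⁻¹ + P z ≠ u1⁻¹ + P u1 := by
        filter_upwards [self_mem_nhdsWithin,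
          mem_nhdsWithin_of_mem_nhds (Metric.closedBall_mem_nhds u1 hδ0)] with z hz1 hz2 heq
        have := hest z hz2
        rw [heq, sub_self, norm_zero] at this
        have h3 : 0 < ‖z - u1‖ := norm_pos_iff.mpr (sub_ne_zero.mpr hz1)
        have : 0 < ‖z - u1‖ / (4 * τ ^ 2) := by positivity
        linarith
      exact h1.frequently.filter_mono nhdsWithin_le_nhds)
  have hmem : u1⁻¹ + P 0 + b * u1 ∈ Metric.ball (u1⁻¹ + P u1) (δ / (4 * τ ^ 2) / 2) := by
    rw [mem_ball_iff_norm, norm_sub_rev]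
    have e : u1⁻¹ + P u1 - (u1⁻¹ + P 0 + b * u1) = P u1 - P 0 - b * u1 := by ring
    rw [e]
    refine (hR u1 (by linarith)).trans_lt ?_
    rw [← hτ]
    have : δ / (4 * τ ^ 2) / 2 = (C + 1) * τ ^ 2 := by rw [hδ, hK]; field_simp; norm_num
    rw [this]
    nlinarith [pow_pos hτ0 2]
  obtain ⟨u, hu, hfu⟩ := hsub hmem
  obtain ⟨h1, h2⟩ := hball u hu
  refine ⟨u, norm_pos_iff.mp (by linarith), by linarith, ?_, hfu⟩
  rw [mem_closedBall_iff_norm] at hu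
  have h1 := norm_sub_norm_le u u1
  linarith

lemma jouk {b t : ℝ} (ht : 0 < t) (hbt : |b| < t ^ 2) (W : ℂ) :
    ((W.re / (t + b / t)) ^ 2 + (W.im / (t - b / t)) ^ 2 ≤ 1) ∨
    ∃ ω : ℂ, t < ‖ω‖ ∧ W = ω + b * ω⁻¹ := by
  obtain ⟨ω1, ω2, hs, hp, hle⟩ : ∃ ω1 ω2 : ℂ, ω1 + ω2 = W ∧ ω1 * ω2 = b ∧ ‖ω2‖ ≤ ‖ω1‖ := by
    obtain ⟨d, hd⟩ := IsAlgClosed.exists_eq_mul_self (W ^ 2 - 4 * (b : ℂ))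
    have hs : (W + d) / 2 + (W - d) / 2 = W := by ring
    have hp : (W + d) / 2 * ((W - d) / 2) = b := by
      linear_combination hd / 4
    rcases le_total ‖(W - d) / 2‖ ‖(W + d) / 2‖ with h | h
    · exact ⟨_, _, hs, hp, h⟩
    · exact ⟨_, _, by rw [add_comm]; exact hs, by rw [mul_comm]; exact hp, h⟩
  by_cases h0 : ω1 = 0
  · left
    subst h0
    have : ω2 = 0 := by simpa using hle
    subst this
    have : W = 0 := by rw [← hs]; simp
    subst this
    simp
  have e2 : ω2 = b * ω1⁻¹ := by rw [← hp]; field_simp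
  rcases lt_or_ge t ‖ω1‖ with h | h
  · right
    exact ⟨ω1, h, by rw [← hs, e2]⟩
  left
  set τ := ‖ω1‖ with hτ
  have hτ0 : 0 < τ := norm_pos_iff.mpr h0
  have hbτ : |b| ≤ τ ^ 2 := by
    have : ‖(b:ℂ)‖ = ‖ω1‖ * ‖ω2‖ := by rw [← hp, norm_mul]
    rw [Complex.norm_real, Real.norm_eq_abs] at this
    rw [this]; nlinarith
  obtain ⟨hb1, hb2⟩ := abs_le.mp hbτ
  obtain ⟨hb3, hb4⟩ := abs_lt.mp hbt
  have hxy : ω1.re ^ 2 + ω1.im ^ 2 = τ ^ 2 := by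
    rw [hτ, Complex.sq_norm, normSq_apply]; ring
  have hre : W.re = ω1.re * (1 + b / τ ^ 2) := by
    rw [← hs, e2, Complex.add_re, Complex.re_ofReal_mul, Complex.inv_re, normSq_eq_norm_sq]
    ring
  have him : W.im = ω1.im * (1 - b / τ ^ 2) := by
    rw [← hs, e2, Complex.add_im, Complex.im_ofReal_mul, Complex.inv_im, normSq_eq_norm_sq]
    ring
  have key : ∀ c x : ℝ, -τ ^ 2 ≤ c → -t ^ 2 < c → c ≤ τ ^ 2 →
      (x * (1 + c / τ ^ 2) / (t + c / t)) ^ 2 ≤ x ^ 2 / τ ^ 2 := by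
    intro c x h1 h2 h3
    have hA : 0 < t + c / t := by
      have : t + c / t = (t ^ 2 + c) / t := by field_simp
      rw [this]; apply div_pos _ ht; linarith
    have hB : 0 ≤ τ + c / τ := by
      have : τ + c / τ = (τ ^ 2 + c) / τ := by field_simp
      rw [this]; apply div_nonneg _ hτ0.le; linarith
    have hAB : τ + c / τ ≤ t + c / t := by
      rw [← sub_nonneg]
      have : t + c / t - (τ + c / τ) = (t - τ) * (t * τ - c) / (t * τ) := by field_simp; ring
      rw [this]
      apply div_nonneg _ (by positivity)
      apply mul_nonneg (by linarith)
      nlinarith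
    have e : x * (1 + c / τ ^ 2) / (t + c / t) = (x / τ) * ((τ + c / τ) / (t + c / t)) := by
      field_simp
    rw [e, mul_pow, div_pow x]
    apply mul_le_of_le_one_right (by positivity)
    apply pow_le_one₀ (by positivity)
    rw [div_le_one hA]; exact hAB
  have k1 := key b ω1.re hb1 hb3 hb2
  have k2 := key (-b) ω1.im (by linarith) (by linarith) (by linarith)
  rw [hre, him]
  have e1 : 1 - b / τ ^ 2 = 1 + (-b) / τ ^ 2 := by ring
  have e2 : t - b / t = t + (-b) / t := by ring
  rw [e1, e2]
  have : ω1.re ^ 2 / τ ^ 2 + ω1.im ^ 2 / τ ^ 2 = 1 := by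
    rw [← add_div, hxy]; field_simp
  linarith

theorem area_thm_s19 {P : ℂ → ℂ} (hP : DifferentiableOn ℂ P (Metric.ball 0 1)) {b : ℝ}
    (hb : HasDerivAt P b 0) (hinj : InjOn (fun u => u⁻¹ + P u) (Metric.ball 0 1 \ {0})) :
    |b| ≤ 1 := by
  replace hb := hb.deriv
  obtain ⟨K, σ0, hK, hσ0, hsolve⟩ := solve_near hP hb
  have main : ∀ ρ : ℝ, 0 < ρ → ρ < 1 → b ^ 2 * ρ ^ 2 ≤ (ρ ^ 2)⁻¹ := by
    intro ρ hρ0 hρ1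
    have hev : ∀ᶠ σ : ℝ in nhdsWithin 0 (Ioi 0),
        b ^ 2 * (ρ ^ 2 - (σ + K * σ ^ 4) ^ 2) ≤ (ρ ^ 2)⁻¹ + 2 * K * σ := by
      have c1 : ∀ᶠ σ : ℝ in nhdsWithin 0 (Ioi 0), σ < σ0 :=
        mem_nhdsWithin_of_mem_nhds (Iio_mem_nhds hσ0)
      have c2 : ∀ᶠ σ : ℝ in nhdsWithin 0 (Ioi 0), |b| * σ ^ 2 < 1 := by
        apply mem_nhdsWithin_of_mem_nhds
        have : Continuous fun σ : ℝ => |b| * σ ^ 2 := by fun_prop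
        exact this.continuousAt.eventually_lt continuousAt_const (by simp)
      have c3 : ∀ᶠ σ : ℝ in nhdsWithin 0 (Ioi 0), σ + K * σ ^ 4 < ρ := by
        apply mem_nhdsWithin_of_mem_nhds
        have : Continuous fun σ : ℝ => σ + K * σ ^ 4 := by fun_prop
        exact this.continuousAt.eventually_lt continuousAt_const (by simpa using hρ0)
      filter_upwards [c1, c2, c3, self_mem_nhdsWithin] with σ h1 h2 h3 h4
      have hσ : 0 < σ := h4
      set s := σ + K * σ ^ 4 with hs
      have hs0 : 0 < s := by positivity
      have hlow := area_lower_s19 hP hb hinj hs0 h3 hρ1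
      have ht : 0 < σ⁻¹ := by positivity
      have hbt : |b| < σ⁻¹ ^ 2 := by
        rw [inv_pow, ← one_div, lt_div_iff₀ (by positivity)]; exact h2
      have hA : 0 < σ⁻¹ + b / σ⁻¹ := by
        have : σ⁻¹ + b / σ⁻¹ = (1 + b * σ ^ 2) / σ := by field_simp
        rw [this]; apply div_pos _ hσ
        nlinarith [neg_abs_le b, pow_pos hσ 2]
      have hB : 0 < σ⁻¹ - b / σ⁻¹ := by
        have : σ⁻¹ - b / σ⁻¹ = (1 - b * σ ^ 2) / σ := by field_simp
        rw [this]; apply div_pos _ hσ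
        nlinarith [le_abs_self b, pow_pos hσ 2]
      have hincl : (fun u => u⁻¹ + P u) '' {u : ℂ | s < ‖u‖ ∧ ‖u‖ < ρ} ⊆
          {w : ℂ | ((w - P 0).re / (σ⁻¹ + b / σ⁻¹)) ^ 2 + ((w - P 0).im / (σ⁻¹ - b / σ⁻¹)) ^ 2 ≤ 1} := by
        rintro _ ⟨u, ⟨hu1, hu2⟩, rfl⟩
        rcases jouk ht hbt (u⁻¹ + P u - P 0) with h | ⟨ω, hω, hW⟩
        · exact h
        exfalso
        have hω0 : ω ≠ 0 := norm_pos_iff.mp (ht.trans hω)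
        have hn : ‖ω⁻¹‖ < σ := by
          rw [norm_inv]; exact inv_lt_of_inv_lt₀ hσ hω
        obtain ⟨v, hv0, hv1, hv2, hv3⟩ := hsolve ω⁻¹ (inv_ne_zero hω0) (hn.trans h1)
        have huv : v = u := by
          apply hinj ⟨by simpa using hv1, by simpa using hv0⟩
            ⟨by rw [mem_ball_zero_iff]; linarith, by
              simpa using norm_pos_iff.mp (hs0.trans hu1)⟩
          simp only
          rw [hv3, inv_inv]
          linear_combination -hW
        subst huv
        have : ‖ω⁻¹‖ + K * ‖ω⁻¹‖ ^ 4 ≤ s := by rw [hs]; gcongr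
        linarith
      have hup := measure_mono (μ := volume) hincl
      rw [ellipse_vol _ _ hA hB] at hup
      have hfin := hlow.trans hup
      rw [ENNReal.ofReal_le_ofReal_iff (by have := Real.pi_pos; positivity)] at hfin
      have hfin2 := le_of_mul_le_mul_left hfin Real.pi_pos
      have e : (σ⁻¹ + b / σ⁻¹) * (σ⁻¹ - b / σ⁻¹) = (σ ^ 2)⁻¹ - b ^ 2 * σ ^ 2 := by field_simp; ring
      rw [e] at hfin2
      have hsl : (σ ^ 2)⁻¹ - 2 * K * σ ≤ (s ^ 2)⁻¹ := by
        have e2 : (σ ^ 2)⁻¹ - 2 * K * σ = (1 - 2 * K * σ ^ 3) / σ ^ 2 := by field_simp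
        rw [e2, ← one_div (s ^ 2), div_le_div_iff₀ (by positivity) (by positivity)]
        have e3 : s ^ 2 = σ ^ 2 * (1 + K * σ ^ 3) ^ 2 := by rw [hs]; ring
        rw [e3]
        have hx : 0 < K * σ ^ 3 := by positivity
        have : (1 - 2 * (K * σ ^ 3)) * (1 + K * σ ^ 3) ^ 2 ≤ 1 := by
          nlinarith [pow_pos hx 2, pow_pos hx 3]
        have h2 : 0 < σ ^ 2 := by positivity
        nlinarith
      nlinarith [mul_nonneg (sq_nonneg b) (sq_nonneg σ)]
    have l1 : Filter.Tendsto (fun σ : ℝ => b ^ 2 * (ρ ^ 2 - (σ + K * σ ^ 4) ^ 2))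
        (nhdsWithin 0 (Ioi 0)) (nhds (b ^ 2 * ρ ^ 2)) := by
      have : Continuous fun σ : ℝ => b ^ 2 * (ρ ^ 2 - (σ + K * σ ^ 4) ^ 2) := by fun_prop
      have := this.tendsto 0
      simp at this
      exact this.mono_left nhdsWithin_le_nhds
    have l2 : Filter.Tendsto (fun σ : ℝ => (ρ ^ 2)⁻¹ + 2 * K * σ)
        (nhdsWithin 0 (Ioi 0)) (nhds ((ρ ^ 2)⁻¹)) := by
      have : Continuous fun σ : ℝ => (ρ ^ 2)⁻¹ + 2 * K * σ := by fun_prop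
      have := this.tendsto 0
      simp only [mul_zero, add_zero] at this
      exact this.mono_left nhdsWithin_le_nhds
    exact le_of_tendsto_of_tendsto l1 l2 hev
  have hev : ∀ᶠ ρ : ℝ in nhdsWithin 1 (Iio 1), b ^ 2 * ρ ^ 4 ≤ 1 := by
    filter_upwards [self_mem_nhdsWithin,
      mem_nhdsWithin_of_mem_nhds (Ioi_mem_nhds (zero_lt_one (α := ℝ)))] with ρ h1 h2
    have h2' : 0 < ρ := h2
    have := main ρ h2' h1
    rw [← one_div, le_div_iff₀ (by positivity)] at this
    linarith
  have l1 : Filter.Tendsto (fun ρ : ℝ => b ^ 2 * ρ ^ 4) (nhdsWithin 1 (Iio 1)) (nhds (b ^ 2)) := by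
    have : Continuous fun ρ : ℝ => b ^ 2 * ρ ^ 4 := by fun_prop
    have := this.tendsto 1
    simp only [one_pow, mul_one] at this
    exact this.mono_left nhdsWithin_le_nhds
  have := le_of_tendsto l1 hev
  exact (sq_le_one_iff_abs_le_one b).mp this

lemma quad_ne {u : ℂ} (hu : ‖u‖ < 1) {c : ℝ} (hc1 : -2 ≤ c) (hc2 : c ≤ 2) :
    1 + u ^ 2 + c * u ≠ 0 := by
  intro h
  obtain ⟨a, b⟩ := u
  have hn : a ^ 2 + b ^ 2 < 1 := by
    have : ‖(⟨a, b⟩ : ℂ)‖ ^ 2 < 1 := by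
      rw [sq_lt_one_iff₀ (norm_nonneg _)]; exact hu
    rw [Complex.sq_norm, normSq_apply] at this
    nlinarith
  have hre := congrArg Complex.re h
  have him := congrArg Complex.im h
  simp [pow_two] at hre him
  have hb : b * (2 * a + c) = 0 := by linarith
  rcases mul_eq_zero.mp hb with h0 | h0
  · subst h0
    have ha : a ^ 2 < 1 := by linarith
    obtain ⟨h1, h2⟩ := abs_lt.mp ((sq_lt_one_iff_abs_lt_one a).mp ha)
    rcases le_total 0 a with h3 | h3
    · nlinarith [mul_nonneg h3 (by linarith : 0 ≤ c + 2), pow_pos (by linarith : 0 < 1 - a) 2]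
    · nlinarith [mul_nonneg (by linarith : 0 ≤ -a) (by linarith : 0 ≤ 2 - c), pow_pos (by linarith : 0 < 1 + a) 2]
  · have : c = -2 * a := by linarith
    subst this
    nlinarith

lemma den_ne {u : ℂ} (hu : ‖u‖ < 1) {x : ℝ} (hx : x ∈ Icc (-2:ℝ) 2) :
    1 + u ^ 2 - x * u ≠ 0 := by
  have := quad_ne hu (c := -x) (by linarith [hx.2]) (by linarith [hx.1])
  push_cast at this
  convert this using 1; ring

lemma q_ne {v : ℂ} (hv : ‖v‖ < 1) {x : ℝ} (hx : x ∈ Icc (-2:ℝ) 2) :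
    (1 + v) ^ 2 - (x:ℂ) ^ 2 * v ≠ 0 := by
  have := quad_ne hv (c := 2 - x ^ 2) (by nlinarith [hx.1, hx.2]) (by nlinarith [sq_nonneg x])
  push_cast at this
  convert this using 1; ring

section meas
variable {μ : Measure ℝ} [IsProbabilityMeasure μ]

lemma ae_Icc (hsupp : μ (Set.Icc (-2 : ℝ) 2)ᶜ = 0) : ∀ᵐ x ∂μ, x ∈ Icc (-2:ℝ) 2 := by
  rw [ae_iff]; exact hsupp

lemma integ {E : Type*} [NormedAddCommGroup E] (hsupp : μ (Set.Icc (-2 : ℝ) 2)ᶜ = 0)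
    {f : ℝ → E} (hf : ContinuousOn f (Icc (-2) 2)) : Integrable f μ := by
  have h := hf.integrableOn_compact (μ := μ) isCompact_Icc
  rwa [IntegrableOn, Measure.restrict_eq_self_of_ae_mem (ae_Icc hsupp)] at h

lemma odd_real (hsupp : μ (Set.Icc (-2 : ℝ) 2)ᶜ = 0)
    (hodd : ∀ k : ℕ, ∫ x : ℝ, x ^ (2 * k + 1) ∂μ = 0)
    {f : ℝ → ℝ} (hf : ContinuousOn f (Icc (-2) 2)) (hfo : ∀ x ∈ Icc (-2:ℝ) 2, f (-x) = - f x) :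
    ∫ x, f x ∂μ = 0 := by
  have hpoly : ∀ p : Polynomial ℝ, ∫ x, (p.eval x - p.eval (-x)) ∂μ = 0 := by
    intro p
    have e : ∀ x : ℝ, p.eval x - p.eval (-x) =
        ∑ i ∈ Finset.range (p.natDegree + 1), p.coeff i * (x ^ i - (-x) ^ i) := by
      intro x
      rw [Polynomial.eval_eq_sum_range, Polynomial.eval_eq_sum_range, ← Finset.sum_sub_distrib]
      exact Finset.sum_congr rfl (fun i _ => by ring)
    simp_rw [e]
    rw [integral_finsetSum]
    · apply Finset.sum_eq_zero
      intro i _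
      rw [integral_const_mul]
      rcases Nat.even_or_odd i with hi | hi
      · simp [hi.neg_pow]
      · obtain ⟨k, rfl⟩ := hi
        have : ∀ x : ℝ, x ^ (2 * k + 1) - (-x) ^ (2 * k + 1) = 2 * x ^ (2 * k + 1) := by
          intro x; rw [Odd.neg_pow ⟨k, rfl⟩]; ring
        simp_rw [this]
        rw [integral_const_mul, hodd]; simp
    · intro i _
      apply integ hsupp
      fun_prop
  have hb : ∀ ε > 0, |∫ x, f x ∂μ| ≤ 0 + ε := by
    intro ε hε
    obtain ⟨p, hp⟩ := exists_polynomial_near_of_continuousOn (-2) 2 f hf ε hε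
    have hpc : Continuous fun x => p.eval x := p.continuous
    have hpi : Integrable (fun x : ℝ => (p.eval x - p.eval (-x)) / 2) μ := by
      apply integ hsupp
      fun_prop
    have e : ∫ x, f x ∂μ = ∫ x, (f x - (p.eval x - p.eval (-x)) / 2) ∂μ := by
      rw [integral_sub (integ hsupp hf) hpi, integral_div, hpoly p]; simp
    rw [e, ← Real.norm_eq_abs]
    have := norm_integral_le_of_norm_le_const (μ := μ) (C := ε)
      (f := fun x => f x - (p.eval x - p.eval (-x)) / 2) (by
        filter_upwards [ae_Icc hsupp] with x hx
        have h1 := hp x hx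
        have hx' : -x ∈ Icc (-2:ℝ) 2 := ⟨by linarith [hx.2], by linarith [hx.1]⟩
        have h2 := hp (-x) hx'
        rw [hfo x hx] at h2
        rw [Real.norm_eq_abs]
        rw [abs_lt] at h1 h2
        rw [abs_le]
        constructor <;> linarith)
    simpa using this
  have := le_of_forall_pos_le_add hb
  exact abs_nonpos_iff.mp this

lemma odd_complex (hsupp : μ (Set.Icc (-2 : ℝ) 2)ᶜ = 0)
    (hodd : ∀ k : ℕ, ∫ x : ℝ, x ^ (2 * k + 1) ∂μ = 0)
    {f : ℝ → ℂ} (hf : ContinuousOn f (Icc (-2) 2)) (hfo : ∀ x ∈ Icc (-2:ℝ) 2, f (-x) = - f x) :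
    ∫ x, f x ∂μ = 0 := by
  have hi := integ hsupp hf
  have h1 := reCLM.integral_comp_comm hi
  have h2 := imCLM.integral_comp_comm hi
  simp only [reCLM_apply, imCLM_apply] at h1 h2
  apply Complex.ext
  · rw [← h1, odd_real hsupp hodd]
    · simp
    · exact Complex.continuous_re.comp_continuousOn hf
    · intro x hx; rw [hfo x hx]; simp
  · rw [← h2, odd_real hsupp hodd]
    · simp
    · exact Complex.continuous_im.comp_continuousOn hf
    · intro x hx; rw [hfo x hx]; simp

noncomputable def AA (μ : Measure ℝ) (v : ℂ) : ℂ :=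
  ∫ x : ℝ, ((x:ℂ) ^ 2 - 1 - v) / ((1 + v) ^ 2 - (x:ℂ) ^ 2 * v) ∂μ

noncomputable def kk (μ : Measure ℝ) (u : ℂ) : ℂ :=
  ∫ x : ℝ, u / (1 + u ^ 2 - x * u) ∂μ

lemma AA_deriv (hsupp : μ (Set.Icc (-2 : ℝ) 2)ᶜ = 0) {v0 : ℂ} (hv0 : ‖v0‖ < 1) :
    HasDerivAt (AA μ) (∫ x : ℝ, (-1 * ((1 + v0) ^ 2 - (x:ℂ) ^ 2 * v0) -
      ((x:ℂ) ^ 2 - 1 - v0) * (2 * (1 + v0) - (x:ℂ) ^ 2)) / ((1 + v0) ^ 2 - (x:ℂ) ^ 2 * v0) ^ 2 ∂μ) v0 := by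
  obtain ⟨R, hR1, hR2⟩ := exists_between hv0
  set S := Metric.closedBall (0:ℂ) R with hS
  have hSn : ∀ v ∈ S, ‖v‖ < 1 := fun v hv => by
    rw [hS, mem_closedBall_zero_iff] at hv; linarith
  set F' : ℂ → ℝ → ℂ := fun v x => (-1 * ((1 + v) ^ 2 - (x:ℂ) ^ 2 * v) -
      ((x:ℂ) ^ 2 - 1 - v) * (2 * (1 + v) - (x:ℂ) ^ 2)) / ((1 + v) ^ 2 - (x:ℂ) ^ 2 * v) ^ 2 with hF'
  have hcont : ContinuousOn (fun p : ℂ × ℝ => F' p.1 p.2) (S ×ˢ Icc (-2:ℝ) 2) := by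
    have : ∀ p ∈ S ×ˢ Icc (-2:ℝ) 2, ((1 + p.1) ^ 2 - (p.2:ℂ) ^ 2 * p.1) ^ 2 ≠ 0 :=
      fun p hp => pow_ne_zero 2 (q_ne (hSn _ hp.1) hp.2)
    rw [hF']
    fun_prop (disch := assumption)
  obtain ⟨C, hC⟩ := ((isCompact_closedBall (0:ℂ) R).prod isCompact_Icc).exists_bound_of_continuousOn hcont
  have hFc : ∀ v : ℂ, ‖v‖ < 1 → ContinuousOn (fun x : ℝ => ((x:ℂ) ^ 2 - 1 - v) / ((1 + v) ^ 2 - (x:ℂ) ^ 2 * v)) (Icc (-2) 2) := by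
    intro v hv
    have : ∀ x ∈ Icc (-2:ℝ) 2, (1 + v) ^ 2 - (x:ℂ) ^ 2 * v ≠ 0 := fun x hx => q_ne hv hx
    fun_prop (disch := assumption)
  have hnhds : S ∈ nhds v0 := by
    rw [hS]
    exact Filter.mem_of_superset (Metric.isOpen_ball.mem_nhds (by simpa using hR1)) Metric.ball_subset_closedBall
  have hv0S : v0 ∈ S := mem_of_mem_nhds hnhds
  refine (hasDerivAt_integral_of_dominated_loc_of_deriv_le (μ := μ) (s := S) (bound := fun _ => C)
    (F := fun v (x : ℝ) => ((x:ℂ) ^ 2 - 1 - v) / ((1 + v) ^ 2 - (x:ℂ) ^ 2 * v))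
    (F' := F') hnhds ?_ ?_ ?_ ?_ ?_ ?_).2
  · filter_upwards [hnhds] with v hv
    exact (integ hsupp (hFc v (hSn v hv))).aestronglyMeasurable
  · exact integ hsupp (hFc v0 hv0)
  · refine (integ hsupp ?_).aestronglyMeasurable
    exact hcont.comp (f := fun x : ℝ => (v0, x)) (by fun_prop) (fun x hx => ⟨hv0S, hx⟩)
  · filter_upwards [ae_Icc hsupp] with x hx v hv
    exact hC (v, x) ⟨hv, hx⟩
  · exact integrable_const _
  · filter_upwards [ae_Icc hsupp] with x hx v hv
    have h1 : HasDerivAt (fun v : ℂ => (x:ℂ) ^ 2 - 1 - v) (-1) v := (hasDerivAt_id v).const_sub _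
    have h2 : HasDerivAt (fun v : ℂ => (1 + v) ^ 2 - (x:ℂ) ^ 2 * v) (2 * (1 + v) - (x:ℂ) ^ 2) v := by
      have h3 := (((hasDerivAt_id v).const_add 1).fun_pow 2).fun_sub ((hasDerivAt_id v).const_mul ((x:ℂ)^2))
      simpa using h3
    exact h1.fun_div h2 (q_ne (hSn v hv) hx)

lemma kk_cont {u : ℂ} (hu : ‖u‖ < 1) :
    ContinuousOn (fun x : ℝ => u / (1 + u ^ 2 - x * u)) (Icc (-2) 2) := by
  have : ∀ x ∈ Icc (-2:ℝ) 2, (1 + u ^ 2 - x * u) ≠ 0 := fun x hx => den_ne hu hx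
  fun_prop (disch := assumption)

lemma kk_eq (hsupp : μ (Set.Icc (-2 : ℝ) 2)ᶜ = 0)
    (hodd : ∀ k : ℕ, ∫ x : ℝ, x ^ (2 * k + 1) ∂μ = 0) {u : ℂ} (hu : ‖u‖ < 1) :
    kk μ u = u * (1 + u ^ 2 * AA μ (u ^ 2)) := by
  have hv : ‖u ^ 2‖ < 1 := by rw [norm_pow]; exact pow_lt_one₀ (norm_nonneg _) hu two_ne_zero
  have hq : ∀ x ∈ Icc (-2:ℝ) 2, (1 + u ^ 2) ^ 2 - (x:ℂ) ^ 2 * u ^ 2 ≠ 0 := fun x hx => q_ne hv hx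
  have hc1 : ContinuousOn (fun x : ℝ => ((x:ℂ) ^ 2 - 1 - u ^ 2) / ((1 + u ^ 2) ^ 2 - (x:ℂ) ^ 2 * u ^ 2)) (Icc (-2) 2) := by
    fun_prop (disch := assumption)
  have hc2 : ContinuousOn (fun x : ℝ => u ^ 2 * x / ((1 + u ^ 2) ^ 2 - (x:ℂ) ^ 2 * u ^ 2)) (Icc (-2) 2) := by
    fun_prop (disch := assumption)
  have h0 : ∫ x : ℝ, u ^ 2 * x / ((1 + u ^ 2) ^ 2 - (x:ℂ) ^ 2 * u ^ 2) ∂μ = 0 := by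
    apply odd_complex hsupp hodd hc2
    intro x _
    push_cast
    ring
  have e : kk μ u = ∫ x : ℝ, ((u + u ^ 3 * (((x:ℂ) ^ 2 - 1 - u ^ 2) / ((1 + u ^ 2) ^ 2 - (x:ℂ) ^ 2 * u ^ 2))) +
      u ^ 2 * x / ((1 + u ^ 2) ^ 2 - (x:ℂ) ^ 2 * u ^ 2)) ∂μ := by
    apply integral_congr_ae
    filter_upwards [ae_Icc hsupp] with x hx
    have h1 := hq x hx
    have h2 := den_ne hu hx
    have h3 : u / (1 + u ^ 2 - x * u) = u * (1 + u ^ 2 + x * u) / ((1 + u ^ 2) ^ 2 - (x:ℂ) ^ 2 * u ^ 2) := by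
      rw [div_eq_div_iff h2 h1]; ring
    rw [h3]
    rw [div_eq_iff h1, add_mul, div_mul_cancel₀ _ h1, add_mul, mul_assoc (u^3), div_mul_cancel₀ _ h1]
    ring
  rw [e, integral_add _ (integ hsupp hc2), h0, integral_add (integrable_const _) ((integ hsupp hc1).const_mul _),
    integral_const_mul]
  · simp [AA]; ring
  · exact (integrable_const _).add ((integ hsupp hc1).const_mul _)

lemma kk_conj (u : ℂ) : kk μ ((starRingEnd ℂ) u) = (starRingEnd ℂ) (kk μ u) := by
  unfold kk
  rw [← integral_conj]
  simp

lemma kk_G (hsupp : μ (Set.Icc (-2 : ℝ) 2)ᶜ = 0) {u : ℂ} (hu : ‖u‖ < 1) (hu0 : u ≠ 0) :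
    kk μ u = ∫ x : ℝ, (u + u⁻¹ - (x : ℂ))⁻¹ ∂μ := by
  apply integral_congr_ae
  filter_upwards [ae_Icc hsupp] with x hx
  have h2 := den_ne hu hx
  have : u + u⁻¹ - x = (1 + u ^ 2 - x * u) / u := by field_simp; ring
  rw [this, inv_div]

lemma den_le {u : ℂ} (hu : ‖u‖ < 1) {x : ℝ} (hx : x ∈ Icc (-2:ℝ) 2) :
    ‖1 + u ^ 2 - x * u‖ ≤ 4 := by
  have h1 : ‖1 + u ^ 2 - x * u‖ ≤ ‖(1:ℂ) + u ^ 2‖ + ‖(x:ℂ) * u‖ := norm_sub_le _ _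
  have h2 : ‖(1:ℂ) + u ^ 2‖ ≤ 1 + ‖u‖ ^ 2 := by
    have := norm_add_le (1:ℂ) (u ^ 2)
    rwa [norm_one, norm_pow] at this
  have h3 : ‖(x:ℂ) * u‖ ≤ 2 * ‖u‖ := by
    rw [norm_mul, Complex.norm_real]
    gcongr
    exact abs_le.mpr hx
  nlinarith [norm_nonneg u]

lemma kk_im_pos (hsupp : μ (Set.Icc (-2 : ℝ) 2)ᶜ = 0) {u : ℂ} (hu : ‖u‖ < 1) (hi : 0 < u.im) :
    0 < (kk μ u).im := by
  have hint := integ hsupp (kk_cont hu)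
  have h2 := imCLM.integral_comp_comm hint
  simp only [imCLM_apply] at h2
  have hn : 0 < 1 - ‖u‖ ^ 2 := by nlinarith [norm_nonneg u]
  have hlb : u.im * (1 - ‖u‖ ^ 2) / 16 ≤ ∫ x : ℝ, (u / (1 + u ^ 2 - x * u)).im ∂μ := by
    have : ∫ x : ℝ, u.im * (1 - ‖u‖ ^ 2) / 16 ∂μ ≤ ∫ x : ℝ, (u / (1 + u ^ 2 - x * u)).im ∂μ := by
      apply integral_mono_ae (integrable_const _) (imCLM.integrable_comp hint)
      filter_upwards [ae_Icc hsupp] with x hx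
      have hd := den_ne hu hx
      have hl := den_le hu hx
      have hp : 0 < ‖1 + u ^ 2 - x * u‖ := norm_pos_iff.mpr hd
      have e : (u / (1 + u ^ 2 - x * u)).im = u.im * (1 - ‖u‖ ^ 2) / ‖1 + u ^ 2 - x * u‖ ^ 2 := by
        rw [Complex.div_im, ← Complex.sq_norm, Complex.sq_norm u, normSq_apply]
        simp [pow_two]
        ring
      show _ ≤ (u / (1 + u ^ 2 - x * u)).im
      rw [e]
      apply div_le_div_of_nonneg_left (by positivity) (by positivity)
      nlinarith
    simpa using this
  unfold kk
  rw [← h2]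
  have : 0 < u.im * (1 - ‖u‖ ^ 2) / 16 := by positivity
  linarith

lemma kk_real_lt (hsupp : μ (Set.Icc (-2 : ℝ) 2)ᶜ = 0) {a b : ℝ} (ha : |a| < 1) (hb : |b| < 1)
    (hab : a < b) : (kk μ a).re < (kk μ b).re := by
  have ha' : ‖(a:ℂ)‖ < 1 := by simpa using ha
  have hb' : ‖(b:ℂ)‖ < 1 := by simpa using hb
  have e : ∀ c : ℝ, ∀ x : ℝ, (c:ℂ) / (1 + (c:ℂ) ^ 2 - x * c) = ((c / (1 + c ^ 2 - x * c) : ℝ) : ℂ) := by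
    intro c x; push_cast; rfl
  have ee : ∀ c : ℝ, kk μ c = ((∫ x : ℝ, c / (1 + c ^ 2 - x * c) ∂μ : ℝ) : ℂ) := by
    intro c
    unfold kk
    simp_rw [e]
    exact integral_ofReal
  have hpos : ∀ c : ℝ, |c| < 1 → ∀ x ∈ Icc (-2:ℝ) 2, 0 < 1 + c ^ 2 - x * c ∧ 1 + c ^ 2 - x * c ≤ 4 := by
    intro c hc x hx
    obtain ⟨h1, h2⟩ := abs_lt.mp hc
    obtain ⟨h3, h4⟩ := hx
    constructor
    · rcases le_total 0 c with h | h
      · nlinarith [pow_pos (by linarith : 0 < 1 - c) 2]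
      · nlinarith [pow_pos (by linarith : 0 < 1 + c) 2]
    · rcases le_total 0 c with h | h
      · nlinarith
      · nlinarith
  have hi : ∀ c : ℝ, |c| < 1 → Integrable (fun x : ℝ => c / (1 + c ^ 2 - x * c)) μ := by
    intro c hc
    apply integ hsupp
    have : ∀ x ∈ Icc (-2:ℝ) 2, 1 + c ^ 2 - x * c ≠ 0 := fun x hx => (hpos c hc x hx).1.ne'
    fun_prop (disch := assumption)
  rw [ee, ee, Complex.ofReal_re, Complex.ofReal_re, ← sub_pos, ← integral_sub (hi b hb) (hi a ha)]
  have hab1 : 0 < 1 - a * b := by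
    obtain ⟨h1, h2⟩ := abs_lt.mp ha
    obtain ⟨h3, h4⟩ := abs_lt.mp hb
    nlinarith
  have hlb : ∫ x : ℝ, (b - a) * (1 - a * b) / 16 ∂μ ≤
      ∫ x : ℝ, (b / (1 + b ^ 2 - x * b) - a / (1 + a ^ 2 - x * a)) ∂μ := by
    apply integral_mono_ae (integrable_const _) ((hi b hb).sub (hi a ha))
    filter_upwards [ae_Icc hsupp] with x hx
    obtain ⟨h1, h2⟩ := hpos a ha x hx
    obtain ⟨h3, h4⟩ := hpos b hb x hx
    have e : b / (1 + b ^ 2 - x * b) - a / (1 + a ^ 2 - x * a) =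
        (b - a) * (1 - a * b) / ((1 + b ^ 2 - x * b) * (1 + a ^ 2 - x * a)) := by
      rw [div_sub_div _ _ h3.ne' h1.ne']; congr 1; ring
    show _ ≤ b / (1 + b ^ 2 - x * b) - a / (1 + a ^ 2 - x * a)
    rw [e]
    apply div_le_div_of_nonneg_left
    · exact mul_nonneg (by linarith) hab1.le
    · positivity
    · nlinarith
  have : 0 < (b - a) * (1 - a * b) / 16 := by
    have : 0 < b - a := by linarith
    positivity
  simp only [integral_const, probReal_univ, one_smul] at hlb
  linarith

lemma kk_inj (hsupp : μ (Set.Icc (-2 : ℝ) 2)ᶜ = 0)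
    (huniv : Set.InjOn (fun z : ℂ => (∫ x : ℝ, (z - (x : ℂ))⁻¹ ∂μ)⁻¹) {z : ℂ | 0 < z.im}) :
    InjOn (kk μ) (Metric.ball 0 1) := by
  have hneg : ∀ u : ℂ, ‖u‖ < 1 → u.im < 0 → (kk μ u).im < 0 := by
    intro u hu hi
    have := kk_im_pos (μ := μ) hsupp (u := (starRingEnd ℂ) u) (by simpa using hu) (by simpa using hi)
    rw [kk_conj] at this
    simpa using this
  have hzero : ∀ u : ℂ, u.im = 0 → (kk μ u).im = 0 := by
    intro u hi
    have h1 : (starRingEnd ℂ) u = u := Complex.conj_eq_iff_im.mpr hi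
    have h2 := kk_conj (μ := μ) u
    rw [h1] at h2
    exact Complex.conj_eq_iff_im.mp h2.symm
  have hlow : ∀ u w : ℂ, ‖u‖ < 1 → ‖w‖ < 1 → u.im < 0 → w.im < 0 → kk μ u = kk μ w → u = w := by
    intro u w hu hw hui hwi h
    have ne0 : ∀ u : ℂ, u.im < 0 → u ≠ 0 := by rintro u hu rfl; simp at hu
    have hψ : ∀ u : ℂ, ‖u‖ < 1 → u.im < 0 → 0 < (u + u⁻¹).im := by
      intro u hu hi
      have h0 : 0 < ‖u‖ := norm_pos_iff.mpr (ne0 u hi)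
      rw [Complex.add_im, Complex.inv_im, normSq_eq_norm_sq]
      have : u.im + -u.im / ‖u‖ ^ 2 = (-u.im) * (1 - ‖u‖ ^ 2) / ‖u‖ ^ 2 := by field_simp; ring
      rw [this]
      have h1 : 0 < 1 - ‖u‖ ^ 2 := by nlinarith
      have h2 : 0 < -u.im := by linarith
      positivity
    have hu0 := ne0 u hui
    have hw0 := ne0 w hwi
    rw [kk_G hsupp hu hu0, kk_G hsupp hw hw0] at h
    have := huniv (hψ u hu hui) (hψ w hw hwi) (by simp only; rw [h])
    have h3 : (u - w) * (u * w - 1) = 0 := by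
      field_simp at this
      linear_combination this
    rcases mul_eq_zero.mp h3 with h4 | h4
    · exact sub_eq_zero.mp h4
    · exfalso
      have : u * w = 1 := sub_eq_zero.mp h4
      have h5 : ‖u‖ * ‖w‖ = 1 := by rw [← norm_mul, this, norm_one]
      nlinarith [norm_nonneg u, norm_nonneg w]
  intro u hu w hw h
  rw [mem_ball_zero_iff] at hu hw
  have him := congrArg Complex.im h
  rcases lt_trichotomy u.im 0 with h1 | h1 | h1 <;> rcases lt_trichotomy w.im 0 with h2 | h2 | h2
  · exact hlow u w hu hw h1 h2 h
  · linarith [hneg u hu h1, hzero w h2]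
  · linarith [hneg u hu h1, kk_im_pos (μ := μ) hsupp hw h2]
  · linarith [hneg w hw h2, hzero u h1]
  · have eu : u = (u.re : ℂ) := Complex.ext (by simp) (by simp [h1])
    have ew : w = (w.re : ℂ) := Complex.ext (by simp) (by simp [h2])
    have au : |u.re| < 1 := by rw [eu] at hu; simpa using hu
    have aw : |w.re| < 1 := by rw [ew] at hw; simpa using hw
    rw [eu, ew] at h
    rcases lt_trichotomy u.re w.re with h3 | h3 | h3
    · have := kk_real_lt (μ := μ) hsupp au aw h3
      rw [h] at this; exact absurd this (lt_irrefl _)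
    · rw [eu, ew, h3]
    · have := kk_real_lt (μ := μ) hsupp aw au h3
      rw [h] at this; exact absurd this (lt_irrefl _)
  · linarith [kk_im_pos (μ := μ) hsupp hw h2, hzero u h1]
  · linarith [hneg w hw h2, kk_im_pos (μ := μ) hsupp hu h1]
  · linarith [kk_im_pos (μ := μ) hsupp hu h1, hzero w h2]
  · have := hlow ((starRingEnd ℂ) u) ((starRingEnd ℂ) w) (by simpa using hu) (by simpa using hw)
      (by simpa using h1) (by simpa using h2) (by rw [kk_conj, kk_conj, h])
    exact (starRingEnd ℂ).injective this

end meas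

/-- Let `μ` be an even probability measure (all odd moments vanish) with support in
`[-2,2]` and moments `aₙ = ∫ xⁿ dμ`.  If the reciprocal Cauchy transform of `μ` is
univalent on the upper half-plane, then `a₂ ≤ 2` and `|1 + 3a₂² - 2a₄| ≤ 1`. -/
theorem grunsky_N2_inequality_even (μ : Measure ℝ) [IsProbabilityMeasure μ]
    (hsupp : μ (Set.Icc (-2 : ℝ) 2)ᶜ = 0)
    (hodd : ∀ k : ℕ, ∫ x : ℝ, x ^ (2 * k + 1) ∂μ = 0)
    (huniv : Set.InjOn (fun z : ℂ => (∫ x : ℝ, (z - (x : ℂ))⁻¹ ∂μ)⁻¹)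
      {z : ℂ | 0 < z.im}) :
    (∫ x : ℝ, x ^ 2 ∂μ) ≤ 2 ∧
    |1 + 3 * (∫ x : ℝ, x ^ 2 ∂μ) ^ 2 - 2 * (∫ x : ℝ, x ^ 4 ∂μ)| ≤ 1 := by
  have hsq : ∀ u : ℂ, ‖u‖ < 1 → ‖u ^ 2‖ < 1 := fun u hu => by
    rw [norm_pow]; exact pow_lt_one₀ (norm_nonneg _) hu two_ne_zero
  have hkinj := kk_inj hsupp huniv
  have hk : ∀ u : ℂ, ‖u‖ < 1 → kk μ u = u * (1 + u ^ 2 * AA μ (u ^ 2)) := fun u hu =>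
    kk_eq hsupp hodd hu
  have hk0 : kk μ 0 = 0 := by rw [hk 0 (by simp)]; simp
  have hroot : ∀ v : ℂ, ‖v‖ < 1 → ∃ u : ℂ, ‖u‖ < 1 ∧ u ^ 2 = v := by
    intro v hv
    obtain ⟨u, hu⟩ := IsAlgClosed.exists_pow_nat_eq v (n := 2) (by norm_num)
    refine ⟨u, ?_, hu⟩
    rw [← hu, norm_pow] at hv
    exact (sq_lt_one_iff₀ (norm_nonneg _)).mp hv
  have hAne : ∀ v : ℂ, ‖v‖ < 1 → 1 + v * AA μ v ≠ 0 := by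
    intro v hv h0
    obtain ⟨u, hu, rfl⟩ := hroot v hv
    have h1 := hk u hu
    rw [h0, mul_zero, ← hk0] at h1
    have := hkinj (by simpa using hu) (by simp) h1
    subst this
    simp at h0
  have hAd : DifferentiableOn ℂ (AA μ) (Metric.ball 0 1) := fun v hv =>
    (AA_deriv hsupp (by simpa using hv)).differentiableAt.differentiableWithinAt
  have i2 : Integrable (fun x : ℝ => x ^ 2) μ := integ hsupp (by fun_prop)
  have i4 : Integrable (fun x : ℝ => x ^ 4) μ := integ hsupp (by fun_prop)
  set a2 := ∫ x : ℝ, x ^ 2 ∂μ with ha2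
  set a4 := ∫ x : ℝ, x ^ 4 ∂μ with ha4
  have hA0 : AA μ 0 = ((a2 - 1 : ℝ) : ℂ) := by
    have e : a2 - 1 = ∫ x : ℝ, (x ^ 2 - 1) ∂μ := by
      rw [integral_sub i2 (integrable_const _)]; simp [ha2]
    rw [e, ← integral_complex_ofReal]
    simp [AA]
  have hA1 : HasDerivAt (AA μ) ((a4 - 3 * a2 + 1 : ℝ) : ℂ) 0 := by
    have h := AA_deriv (μ := μ) hsupp (v0 := 0) (by simp)
    convert h using 1
    have e : a4 - 3 * a2 + 1 = ∫ x : ℝ, (x ^ 4 - 3 * x ^ 2 + 1) ∂μ := by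
      have i5 : Integrable (fun x : ℝ => x ^ 4 - 3 * x ^ 2) μ := i4.sub (i2.const_mul 3)
      rw [integral_add i5 (integrable_const _),
        integral_sub i4 (i2.const_mul 3), integral_const_mul]; simp [ha2, ha4]
    rw [e, ← integral_complex_ofReal]
    congr 1
    funext x
    push_cast
    ring
  constructor
  · have hA2d : DifferentiableOn ℂ (fun u => AA μ (u ^ 2)) (Metric.ball 0 1) :=
      hAd.comp (f := fun u : ℂ => u ^ 2) (by fun_prop) (fun u hu => by
        rw [mem_ball_zero_iff] at hu ⊢; exact hsq u hu)
    have hne : ∀ u ∈ Metric.ball (0:ℂ) 1, 1 + u ^ 2 * AA μ (u ^ 2) ≠ 0 := fun u hu =>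
      hAne _ (hsq u (by simpa using hu))
    have hPd : DifferentiableOn ℂ (fun u => -(u * AA μ (u ^ 2)) / (1 + u ^ 2 * AA μ (u ^ 2)))
        (Metric.ball 0 1) := by
      fun_prop (disch := assumption)
    have hder : HasDerivAt (fun u => -(u * AA μ (u ^ 2)) / (1 + u ^ 2 * AA μ (u ^ 2)))
        ((1 - a2 : ℝ) : ℂ) 0 := by
      have hs : HasDerivAt (fun u : ℂ => u ^ 2) 0 0 := by simpa using hasDerivAt_pow 2 (0:ℂ)
      have h1 : HasDerivAt (fun u : ℂ => AA μ (u ^ 2)) (((a4 - 3 * a2 + 1 : ℝ) : ℂ) * 0) 0 := by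
        refine HasDerivAt.comp (h₂ := AA μ) (h := fun u : ℂ => u ^ 2) 0 ?_ hs
        simpa using hA1
      have h2 := ((hasDerivAt_id (0:ℂ)).fun_mul h1).fun_neg.fun_div
        ((hs.fun_mul h1).const_add 1) (by simp)
      refine h2.congr_deriv ?_
      simp [hA0]
    have := area_thm_s19 hPd hder (by
      intro u hu w hw h
      obtain ⟨hu1, hu0⟩ := hu
      obtain ⟨hw1, hw0⟩ := hw
      have e : ∀ u : ℂ, u ∈ Metric.ball (0:ℂ) 1 → u ≠ 0 →
          u⁻¹ + -(u * AA μ (u ^ 2)) / (1 + u ^ 2 * AA μ (u ^ 2)) = (kk μ u)⁻¹ := by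
        intro u hu hu0
        have h1 := hne u hu
        rw [hk u (by simpa using hu)]
        field_simp
        ring
      simp only at h
      rw [e u hu1 hu0, e w hw1 hw0] at h
      exact hkinj hu1 hw1 (inv_injective h))
    linarith [(abs_le.mp this).1]
  · have hne : ∀ v ∈ Metric.ball (0:ℂ) 1, 1 + v * AA μ v ≠ 0 := fun v hv =>
      hAne _ (by simpa using hv)
    have hne2 : ∀ v ∈ Metric.ball (0:ℂ) 1, (1 + v * AA μ v) ^ 2 ≠ 0 := fun v hv =>
      pow_ne_zero 2 (hne v hv)
    have hPd : DifferentiableOn ℂ (fun v => -(AA μ v * (2 + v * AA μ v)) / (1 + v * AA μ v) ^ 2)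
        (Metric.ball 0 1) := by
      fun_prop (disch := assumption)
    have hder : HasDerivAt (fun v => -(AA μ v * (2 + v * AA μ v)) / (1 + v * AA μ v) ^ 2)
        ((1 + 3 * a2 ^ 2 - 2 * a4 : ℝ) : ℂ) 0 := by
      have hv := (hasDerivAt_id (0:ℂ)).fun_mul hA1
      have h2 := (hA1.fun_mul (hv.const_add 2)).fun_neg.fun_div
        ((hv.const_add 1).fun_pow 2) (by simp)
      refine h2.congr_deriv ?_
      simp [hA0]
      ring
    exact area_thm_s19 hPd hder (by
      intro v hv w hw h
      obtain ⟨hv1, hv0⟩ := hv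
      obtain ⟨hw1, hw0⟩ := hw
      have e : ∀ v : ℂ, v ∈ Metric.ball (0:ℂ) 1 → v ≠ 0 →
          v⁻¹ + -(AA μ v * (2 + v * AA μ v)) / (1 + v * AA μ v) ^ 2 =
            (v * (1 + v * AA μ v) ^ 2)⁻¹ := by
        intro v hv hv0
        have h1 := hne v hv
        field_simp
        ring
      simp only at h
      rw [e v hv1 hv0, e w hw1 hw0] at h
      have h := inv_injective h
      obtain ⟨x, hx, rfl⟩ := hroot v (by simpa using hv1)
      obtain ⟨y, hy, rfl⟩ := hroot w (by simpa using hw1)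
      have hxy : kk μ x ^ 2 = kk μ y ^ 2 := by
        rw [hk x hx, hk y hy, mul_pow, mul_pow]; exact h
      have hyn : kk μ (-y) = - kk μ y := by
        rw [hk y hy, hk (-y) (by simpa using hy)]; simp
      rcases sq_eq_sq_iff_eq_or_eq_neg.mp hxy with h1 | h1
      · rw [hkinj (by simpa using hx) (by simpa using hy) h1]
      · rw [← hyn] at h1
        rw [hkinj (by simpa using hx) (by simpa using hy) h1]; ring)
end
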